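/- arXiv:1809.09232 — 2 statements merged into one kernel-verified Lean document; each statement's English description precedes it below -/
import Mathlib

section
/- Let H and H' be non-isomorphic graphs each of which is either 3-connected or isomorphic to K_3. Then for every integer q ≥ 2 we have M_q(H) ≠ M_q(H'); that is, there exists a graph that is q-Ramsey-minimal for one of H, H' but not for the other. -/
open SimpleGraph

/-- The colouring `c` contains a copy of `H` in `G` all of whose edges have colour `i`. -/
def HasMonoCopyColor {V W : Type*} (G : SimpleGraph V) (H : SimpleGraph W) {q : ℕ}
    (c : Sym2 V → Fin q) (i : Fin q) : Prop :=
  ∃ f : W ↪ V, ∀ a b, H.Adj a b → G.Adj (f a) (f b) ∧ c s(f a, f b) = i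

/-- The colouring `c` contains a monochromatic copy of `H` in `G`. -/
def HasMonoCopy {V W : Type*} (G : SimpleGraph V) (H : SimpleGraph W) {q : ℕ}
    (c : Sym2 V → Fin q) : Prop :=
  ∃ i : Fin q, HasMonoCopyColor G H c i

/-- `G` is `q`-Ramsey for `H`: every `q`-colouring of the edges of `G` contains a
monochromatic copy of `H`. -/
def IsRamsey (q : ℕ) {V W : Type*} (G : SimpleGraph V) (H : SimpleGraph W) : Prop :=
  ∀ c : Sym2 V → Fin q, HasMonoCopy G H c

/-- `G` is `q`-Ramsey-minimal for `H`: `G` is `q`-Ramsey for `H` but no proper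
subgraph of `G` is. -/
def IsRamseyMinimal (q : ℕ) {V W : Type*} (G : SimpleGraph V) (H : SimpleGraph W) : Prop :=
  IsRamsey q G H ∧ ∀ G' : G.Subgraph, G' ≠ ⊤ → ¬ IsRamsey q G'.coe H

/-- `H` is 3-connected: it has at least 4 vertices and deleting any set of at most
2 vertices leaves a connected graph. -/
def ThreeConnected {V : Type*} [Fintype V] (H : SimpleGraph V) : Prop :=
  4 ≤ Fintype.card V ∧
    ∀ S : Finset V, S.card ≤ 2 → (H.induce ((↑S : Set V)ᶜ)).Connected

/-- `H` is 3-connected or isomorphic to `K₃`. -/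
def ThreeConnOrK3 {V : Type*} [Fintype V] (H : SimpleGraph V) : Prop :=
  ThreeConnected H ∨ Nonempty (H ≃g (⊤ : SimpleGraph (Fin 3)))

/-- Any `J` consisting of at most `s` members of the family `E` is Berge-acyclic, expressed by
counting: the union is as large as that of a hyperforest. -/
def SparseFamily {V I : Type} (s : ℕ) (E : I → Finset V) : Prop :=
  ∀ J : Finset I, J.Nonempty → J.card ≤ s → ∀ U : Finset V, (∀ i ∈ J, E i ⊆ U) →
    ∑ i ∈ J, (E i).card + 1 ≤ U.card + J.card

/-- Every `q`-colouring of `V` makes some member of the family `E` monochromatic. -/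
def Unavoidable {V I : Type} (q : ℕ) (E : I → Finset V) : Prop :=
  ∀ χ : V → Fin q, ∃ i γ, ∀ x ∈ E i, χ x = γ

/-- There are `s`-sparse `k`-uniform families which are not `q`-colourable, for every `k`. -/
def HasSparseUnavoidable (q s : ℕ) : Prop :=
  ∀ k : ℕ, 1 ≤ k → ∃ (V I : Type) (_ : Fintype V) (_ : Fintype I) (E : I → Finset V),
    (∀ i, (E i).card = k) ∧ SparseFamily s E ∧ Unavoidable q E

theorem exists_card_eq_of_coloring {q k : ℕ} (κ : Fin (q * (k - 1) + 1) → Fin q) :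
    ∃ (K : Finset (Fin (q * (k - 1) + 1))) (γ : Fin q), K.card = k ∧ ∀ x ∈ K, κ x = γ := by
  classical
  obtain ⟨γ, -, hγ⟩ := Finset.exists_lt_card_fiber_of_mul_lt_card_of_maps_to
    (s := (Finset.univ : Finset (Fin (q * (k - 1) + 1)))) (t := (Finset.univ : Finset (Fin q)))
    (f := κ) (n := k - 1) (by simp) (by simp)
  obtain ⟨K, hK, hc⟩ := Finset.exists_subset_card_eq (n := k) (Nat.le_of_pred_lt hγ)
  exact ⟨K, γ, hc, fun x hx => (Finset.mem_filter.1 (hK hx)).2⟩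

theorem hasSparseUnavoidable_zero (q : ℕ) : HasSparseUnavoidable q 0 := by
  intro k _
  refine ⟨Fin (q * (k - 1) + 1), {K : Finset (Fin (q * (k - 1) + 1)) // K.card = k},
    inferInstance, inferInstance, Subtype.val, fun i => i.2, ?_, ?_⟩
  · intro J hJ h0
    have := hJ.card_pos
    omega
  · intro χ
    obtain ⟨K, γ, hK, h⟩ := exists_card_eq_of_coloring χ
    exact ⟨⟨K, hK⟩, γ, h⟩

/-- The inequality defining sparsity is inherited by families of subsets. -/
theorem sparse_inequality_of_subset {V I : Type} [DecidableEq V] (J : Finset I)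
    (E Y : I → Finset V) (hY : ∀ i ∈ J, Y i ⊆ E i)
    (h : ∑ i ∈ J, (E i).card + 1 ≤ (J.biUnion E).card + J.card) :
    ∑ i ∈ J, (Y i).card + 1 ≤ (J.biUnion Y).card + J.card := by
  have h1 : (J.biUnion E).card ≤ (J.biUnion Y).card + ∑ i ∈ J, (E i \ Y i).card := by
    calc (J.biUnion E).card ≤ (J.biUnion Y ∪ J.biUnion fun i => E i \ Y i).card := by
          apply Finset.card_le_card
          intro x
          simp only [Finset.mem_biUnion, Finset.mem_union, Finset.mem_sdiff]
          rintro ⟨i, hi, hx⟩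
          by_cases hxY : x ∈ Y i
          · exact Or.inl ⟨i, hi, hxY⟩
          · exact Or.inr ⟨i, hi, hx, hxY⟩
      _ ≤ _ := (Finset.card_union_le _ _).trans
          (Nat.add_le_add_left Finset.card_biUnion_le _)
  have h2 : ∑ i ∈ J, (E i).card = ∑ i ∈ J, (Y i).card + ∑ i ∈ J, (E i \ Y i).card := by
    rw [← Finset.sum_add_distrib]
    refine Finset.sum_congr rfl fun i hi => ?_
    have := Finset.card_sdiff_add_card_eq_card (hY i hi)
    omega
  omega

/-- A family of sets, each meeting every fibre of `π` at most once, such that for every colouring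
all the fibres of index below `t` can be assumed monochromatic. -/
def HasPartiteFamily (q k s a t : ℕ) : Prop :=
  ∃ (V I : Type) (_ : Fintype V) (_ : Fintype I) (E : I → Finset V) (π : V → Fin a),
    (∀ i, (E i).card = k) ∧ (∀ i, Set.InjOn π (E i)) ∧ SparseFamily s E ∧
    ∀ χ : V → Fin q, ∃ κ : Fin a → Fin q, ∀ K : Finset (Fin a), K.card = k →
      ∃ i, (∀ x ∈ E i, π x ∈ K) ∧ ∀ x ∈ E i, (π x).val < t → χ x = κ (π x)

theorem hasPartiteFamily_zero (q k s a : ℕ) (hq : 0 < q) : HasPartiteFamily q k s a 0 := by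
  classical
  refine ⟨{K : Finset (Fin a) // K.card = k} × Fin a, {K : Finset (Fin a) // K.card = k},
    inferInstance, inferInstance, fun K => K.1.map ⟨fun x => (K, x), fun x y h => by simpa using h⟩,
    Prod.snd, fun i => by simpa using i.2, ?_, ?_, ?_⟩
  · rintro i x hx y hy hxy
    simp only [Finset.coe_map, Set.mem_image] at hx hy
    obtain ⟨x, -, rfl⟩ := hx
    obtain ⟨y, -, rfl⟩ := hy
    exact congrArg (Prod.mk i) hxy
  · intro J hJ _ U hU
    have hd : (J.biUnion fun K : {K : Finset (Fin a) // K.card = k} =>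
        K.1.map ⟨fun x => (K, x), fun x y h => by simpa using h⟩).card
        = ∑ K ∈ J, (K.1.map ⟨fun x => (K, x), fun x y h => by simpa using h⟩).card := by
      apply Finset.card_biUnion
      intro K _ K' _ hne
      rw [Function.onFun, Finset.disjoint_left]
      intro x hx hx'
      simp only [Finset.mem_map] at hx hx'
      obtain ⟨_, -, rfl⟩ := hx
      obtain ⟨_, -, h⟩ := hx'
      exact hne (congrArg Prod.fst h).symm
    have h1 := Finset.card_le_card (Finset.biUnion_subset.2 hU)
    rw [hd] at h1
    exact Nat.add_le_add h1 hJ.card_pos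
  · intro χ
    refine ⟨fun _ => ⟨0, hq⟩, fun K hK => ⟨⟨K, hK⟩, fun x hx => ?_, by simp⟩⟩
    obtain ⟨y, hy, rfl⟩ := Finset.mem_map.1 hx
    exact hy

theorem HasPartiteFamily.succ {q k s a t : ℕ} (ht : t < a) (hs : HasSparseUnavoidable q s)
    (h : HasPartiteFamily q k (s + 1) a t) : HasPartiteFamily q k (s + 1) a (t + 1) := by
  classical
  obtain ⟨V, I, _, _, E, π, hk, hπ, hE, hχ⟩ := h
  set p : Fin a := ⟨t, ht⟩ with hp
  have hlt : ∀ x : Fin a, x.val < t + 1 → x ≠ p → x.val < t := by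
    intro x hx hxp
    have : x.val ≠ t := fun h => hxp (Fin.ext h)
    omega
  rcases isEmpty_or_nonempty {x // π x = p} with hemp | hnon
  · refine ⟨V, I, inferInstance, inferInstance, E, π, hk, hπ, hE, fun χ => ?_⟩
    obtain ⟨κ, hκ⟩ := hχ χ
    refine ⟨κ, fun K hK => ?_⟩
    obtain ⟨i, h1, h2⟩ := hκ K hK
    exact ⟨i, h1, fun x hx hxt => h2 x hx (hlt _ hxt fun h => hemp.elim ⟨x, h⟩)⟩
  obtain ⟨V₂, I₂, _, _, E₂, hn, hE₂, hU⟩ := hs (Fintype.card {x // π x = p}) Fintype.card_pos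
  have heq : ∀ F, Nonempty ({x // π x = p} ≃ E₂ F) := fun F =>
    Fintype.card_eq.1 (by simp [hn F])
  let e F := (heq F).some
  let g₀ : I₂ → V → V₂ ⊕ I₂ × V := fun F x =>
    if hx : π x = p then Sum.inl (e F ⟨x, hx⟩).1 else Sum.inr (F, x)
  have g_pos : ∀ F x (hx : π x = p), g₀ F x = Sum.inl (e F ⟨x, hx⟩).1 := fun F x hx => dif_pos hx
  have g_neg : ∀ F x, π x ≠ p → g₀ F x = Sum.inr (F, x) := fun F x hx => dif_neg hx
  have g_inj : ∀ F, Function.Injective (g₀ F) := by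
    intro F x y hxy
    by_cases hx : π x = p <;> by_cases hy : π y = p
    · rw [g_pos F x hx, g_pos F y hy] at hxy
      simpa using (e F).injective (Subtype.ext (Sum.inl_injective hxy))
    · rw [g_pos F x hx, g_neg F y hy] at hxy
      simp at hxy
    · rw [g_neg F x hx, g_pos F y hy] at hxy
      simp at hxy
    · rw [g_neg F x hx, g_neg F y hy] at hxy
      simpa using hxy
  let g : I₂ → V ↪ V₂ ⊕ I₂ × V := fun F => ⟨g₀ F, g_inj F⟩
  let π' : V₂ ⊕ I₂ × V → Fin a := Sum.elim (fun _ => p) fun y => π y.2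
  have hπg : ∀ F x, π' (g₀ F x) = π x := by
    intro F x
    by_cases hx : π x = p
    · rw [g_pos F x hx, hx]; rfl
    · rw [g_neg F x hx]; rfl
  refine ⟨V₂ ⊕ I₂ × V, I₂ × I, inferInstance, inferInstance, fun P => (E P.2).map (g P.1), π',
    fun P => by simp [hk], ?_, ?_, ?_⟩
  · rintro ⟨F, i⟩ x hx y hy hxy
    simp only [Finset.coe_map, Set.mem_image] at hx hy
    obtain ⟨x, hx, rfl⟩ := hx
    obtain ⟨y, hy, rfl⟩ := hy
    rw [show π' (g F x) = π x from hπg F x, show π' (g F y) = π y from hπg F y] at hxy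
    rw [hπ i hx hy hxy]
  · intro J hJ hJs U hJU
    let 𝓕 := J.image Prod.fst
    let JF : I₂ → Finset I := fun F => (J.filter fun P => P.1 = F).image Prod.snd
    have mem_JF : ∀ F i, i ∈ JF F ↔ (F, i) ∈ J := by
      intro F i
      simp [JF]
    have sum_J : ∀ w : I → ℕ, ∑ P ∈ J, w P.2 = ∑ F ∈ 𝓕, ∑ i ∈ JF F, w i := by
      intro w
      rw [Finset.sum_sigma', eq_comm]
      refine Finset.sum_bij (fun x _ => (x.1, x.2)) ?_ ?_ ?_ ?_
      · intro x hx
        exact (mem_JF _ _).1 (Finset.mem_sigma.1 hx).2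
      · rintro ⟨_, _⟩ _ ⟨_, _⟩ _ h
        simpa using h
      · rintro ⟨F, i⟩ h
        exact ⟨⟨F, i⟩, Finset.mem_sigma.2 ⟨Finset.mem_image_of_mem Prod.fst h, (mem_JF _ _).2 h⟩,
          rfl⟩
      · intros; rfl
    have card_J : J.card = ∑ F ∈ 𝓕, (JF F).card := by
      simpa using sum_J fun _ => 1
    have JF_pos : ∀ F ∈ 𝓕, (JF F).Nonempty := by
      intro F hF
      obtain ⟨⟨F, i⟩, hP, rfl⟩ := Finset.mem_image.1 hF
      exact ⟨i, (mem_JF _ _).2 hP⟩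
    have JF_le : ∀ F ∈ 𝓕, (JF F).card ≤ J.card := fun F hF => by
      rw [card_J]
      exact Finset.single_le_sum (f := fun F => (JF F).card) (fun _ _ => Nat.zero_le _) hF
    let UF : I₂ → Finset V := fun F => (JF F).biUnion E
    let Y : I₂ → Finset V₂ := fun F =>
      ((UF F).subtype fun x => π x = p).image fun x => (e F x).1
    let Z : I₂ → Finset V := fun F => (UF F).filter fun x => π x ≠ p
    have card_Y : ∀ F, (Y F).card = ((UF F).filter fun x => π x = p).card := by
      intro F
      exact (Finset.card_image_of_injective _
        (Subtype.val_injective.comp (e F).injective)).trans (Finset.card_subtype _ _)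
    have card_UF : ∀ F, (UF F).card = (Y F).card + (Z F).card := by
      intro F
      rw [card_Y]
      exact (Finset.card_filter_add_card_filter_not _).symm
    have hEF : ∀ F ∈ 𝓕, ∑ i ∈ JF F, (E i).card + 1 ≤ (UF F).card + (JF F).card := fun F hF =>
      hE (JF F) (JF_pos F hF) ((JF_le F hF).trans hJs) _ fun i hi =>
        Finset.subset_biUnion_of_mem E hi
    have hYE : ∀ F ∈ 𝓕, Y F ⊆ E₂ F := by
      intro F _ y hy
      obtain ⟨x, -, rfl⟩ := Finset.mem_image.1 hy
      exact (e F x).2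
    have hU' : (𝓕.biUnion Y).card + ∑ F ∈ 𝓕, (Z F).card ≤ U.card := by
      have : ∑ F ∈ 𝓕, (Z F).card = (𝓕.sigma Z).card := (Finset.card_sigma _ _).symm
      rw [this, ← Finset.card_disjSum]
      refine Finset.card_le_card_of_injOn
        (Sum.elim Sum.inl fun x => Sum.inr (x.1, x.2)) ?_ ?_
      · intro x hx
        rcases x with y | ⟨F, z⟩
        · simp only [Finset.mem_coe, Finset.inl_mem_disjSum, Finset.mem_biUnion, Y, UF,
            Finset.mem_image, Finset.mem_subtype] at hx
          obtain ⟨F, -, ⟨x, hx⟩, ⟨i, hi, hxi⟩, rfl⟩ := hx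
          refine hJU (F, i) ((mem_JF _ _).1 hi) (Finset.mem_map.2 ⟨x, hxi, ?_⟩)
          exact g_pos F x hx
        · simp only [Finset.mem_coe, Finset.inr_mem_disjSum, Finset.mem_sigma, Z, UF,
            Finset.mem_filter, Finset.mem_biUnion] at hx
          obtain ⟨-, ⟨i, hi, hzi⟩, hz⟩ := hx
          exact hJU (F, i) ((mem_JF _ _).1 hi) (Finset.mem_map.2 ⟨z, hzi, g_neg F z hz⟩)
      · rintro (x | ⟨F, x⟩) _ (y | ⟨F', y⟩) _ h <;> simp_all
    have hY : ∑ F ∈ 𝓕, (Y F).card + 1 ≤ (𝓕.biUnion Y).card + 𝓕.card := by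
      have h𝓕 : 𝓕.Nonempty := hJ.image _
      by_cases hcard : 𝓕.card ≤ s
      · exact sparse_inequality_of_subset 𝓕 E₂ Y hYE
          (hE₂ 𝓕 h𝓕 hcard _ fun i hi => Finset.subset_biUnion_of_mem E₂ hi)
      · have hone : ∀ F ∈ 𝓕, (JF F).card ≤ 1 := by
          by_contra! hcon
          have : ∑ F ∈ 𝓕, 1 < ∑ F ∈ 𝓕, (JF F).card :=
            Finset.sum_lt_sum (fun F hF => (JF_pos F hF).card_pos) hcon
          simp only [Finset.sum_const, smul_eq_mul, mul_one] at this
          omega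
        have hY1 : ∀ F ∈ 𝓕, (Y F).card ≤ 1 := by
          intro F hF
          rw [card_Y, Finset.card_le_one]
          intro x hx y hy
          simp only [Finset.mem_filter, UF, Finset.mem_biUnion] at hx hy
          obtain ⟨⟨i, hi, hxi⟩, hx⟩ := hx
          obtain ⟨⟨j, hj, hyj⟩, hy⟩ := hy
          obtain rfl := Finset.card_le_one.1 (hone F hF) i hi j hj
          exact hπ i hxi hyj (hx.trans hy.symm)
        rcases (𝓕.biUnion Y).eq_empty_or_nonempty with h0 | h0
        · have : ∀ F ∈ 𝓕, (Y F).card = 0 := fun F hF =>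
            Finset.card_eq_zero.2 (Finset.subset_empty.1
              (h0 ▸ Finset.subset_biUnion_of_mem Y hF))
          rw [Finset.sum_eq_zero this]
          have := h𝓕.card_pos
          omega
        · have h1 := Finset.sum_le_sum hY1
          simp only [Finset.sum_const, smul_eq_mul, mul_one] at h1
          have := h0.card_pos
          omega
    have h1 := Finset.sum_le_sum hEF
    simp only [Finset.sum_add_distrib, card_UF] at h1
    simp only [Finset.sum_const, smul_eq_mul, mul_one] at h1
    simp only [Finset.card_map]
    rw [sum_J fun i => (E i).card]
    omega
  · intro χ
    obtain ⟨F, γ, hF⟩ := hU (χ ∘ Sum.inl)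
    obtain ⟨κ, hκ⟩ := hχ (χ ∘ g₀ F)
    refine ⟨Function.update κ p γ, fun K hK => ?_⟩
    obtain ⟨i, h1, h2⟩ := hκ K hK
    refine ⟨(F, i), ?_, ?_⟩
    · intro x hx
      obtain ⟨y, hy, rfl⟩ := Finset.mem_map.1 hx
      exact (hπg F y).symm ▸ h1 y hy
    · intro x hx hxt
      obtain ⟨x, hy, rfl⟩ := Finset.mem_map.1 hx
      change (π' (g₀ F x)).val < t + 1 at hxt
      change χ (g₀ F x) = Function.update κ p γ (π' (g₀ F x))
      rw [hπg] at hxt ⊢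
      by_cases hxp : π x = p
      · rw [hxp, Function.update_self, g_pos F x hxp]
        exact hF _ (e F ⟨x, hxp⟩).2
      · rw [Function.update_of_ne hxp]
        exact h2 x hy (hlt _ hxt hxp)

theorem hasSparseUnavoidable (q s : ℕ) (hq : 0 < q) : HasSparseUnavoidable q s := by
  induction s with
  | zero => exact hasSparseUnavoidable_zero q
  | succ s ih =>
    intro k _
    have key : ∀ t ≤ q * (k - 1) + 1, HasPartiteFamily q k (s + 1) (q * (k - 1) + 1) t := by
      intro t
      induction t with
      | zero => exact fun _ => hasPartiteFamily_zero q k _ _ hq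
      | succ t iht => exact fun ht => (iht (by omega)).succ (by omega) ih
    obtain ⟨V, I, _, _, E, π, hk, -, hE, hχ⟩ := key _ le_rfl
    refine ⟨V, I, inferInstance, inferInstance, E, hk, hE, fun χ => ?_⟩
    obtain ⟨κ, hκ⟩ := hχ χ
    obtain ⟨K, γ, hK, hγ⟩ := exists_card_eq_of_coloring κ
    obtain ⟨i, h1, h2⟩ := hκ K hK
    exact ⟨i, γ, fun x hx => (h2 x hx (π x).2).trans (hγ _ (h1 x hx))⟩

/-- Any nonempty set of at most `s` members of the system `ρ` of `k`-tuples has a member sharing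
at most one of its entries with the other members. -/
def HasLeaves {V I : Type} {k : ℕ} (s : ℕ) (ρ : I → Fin k → V) : Prop :=
  ∀ J : Finset I, J.Nonempty → J.card ≤ s → ∃ i ∈ J, ∀ a b : Fin k,
    (∃ j ∈ J, j ≠ i ∧ ∃ c, ρ j c = ρ i a) → (∃ j ∈ J, j ≠ i ∧ ∃ c, ρ j c = ρ i b) → a = b

theorem SparseFamily.exists_leaf {V I : Type} {s : ℕ} {E : I → Finset V} (hE : SparseFamily s E)
    (J : Finset I) (hJ : J.Nonempty) (hJs : J.card ≤ s) :
    ∃ i ∈ J, ∀ x ∈ E i, ∀ y ∈ E i, (∃ j ∈ J, j ≠ i ∧ x ∈ E j) → (∃ j ∈ J, j ≠ i ∧ y ∈ E j) →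
      x = y := by
  classical
  by_contra! hcon
  let U := J.biUnion E
  let d : V → ℕ := fun x => (J.filter fun i => x ∈ E i).card
  have hd : ∀ x, ∀ i ∈ J, x ∈ E i → (∃ j ∈ J, j ≠ i ∧ x ∈ E j) → 2 ≤ d x := by
    rintro x i hi hx ⟨j, hj, hji, hxj⟩
    exact Finset.one_lt_card.2 ⟨j, by simp [hj, hxj], i, by simp [hi, hx], hji⟩
  have count : ∀ (p : V → Prop) [DecidablePred p],
      ∑ i ∈ J, ((E i).filter p).card = ∑ x ∈ U, if p x then d x else 0 := by
    intro p _
    have h1 : ∀ i ∈ J, ((E i).filter p).card = ∑ x ∈ U, if x ∈ E i ∧ p x then 1 else 0 := by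
      intro i hi
      rw [Finset.card_eq_sum_ones, ← Finset.sum_filter]
      refine Finset.sum_congr ?_ fun _ _ => rfl
      ext x
      simp only [Finset.mem_filter, U, Finset.mem_biUnion]
      exact ⟨fun h => ⟨⟨i, hi, h.1⟩, h⟩, fun h => h.2⟩
    rw [Finset.sum_congr rfl h1, Finset.sum_comm]
    refine Finset.sum_congr rfl fun x _ => ?_
    by_cases hp : p x
    · simp [hp, d]
    · simp [hp]
  have hall : ∑ i ∈ J, (E i).card = ∑ x ∈ U, d x := by simpa using count fun _ => True
  have hshared : 2 * J.card ≤ ∑ x ∈ U, if 2 ≤ d x then d x else 0 := by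
    rw [← count fun x => 2 ≤ d x, mul_comm, ← smul_eq_mul, ← Finset.sum_const]
    refine Finset.sum_le_sum fun i hi => ?_
    obtain ⟨x, hx, y, hy, hxs, hys, hxy⟩ := hcon i hi
    exact Finset.one_lt_card.2 ⟨x, Finset.mem_filter.2 ⟨hx, hd x i hi hx hxs⟩, y,
      Finset.mem_filter.2 ⟨hy, hd y i hi hy hys⟩, hxy⟩
  have hpt : ∑ x ∈ U, ((if 2 ≤ d x then d x else 0) + 2) ≤ ∑ x ∈ U, 2 * d x := by
    refine Finset.sum_le_sum fun x hx => ?_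
    obtain ⟨i, hi, hxi⟩ := Finset.mem_biUnion.1 hx
    have : 0 < d x := Finset.card_pos.2 ⟨i, Finset.mem_filter.2 ⟨hi, hxi⟩⟩
    split_ifs <;> omega
  rw [Finset.sum_add_distrib, ← Finset.mul_sum, Finset.sum_const, smul_eq_mul] at hpt
  have := hE J hJ hJs U fun i hi => Finset.subset_biUnion_of_mem E hi
  omega

theorem exists_system_hasLeaves {q k : ℕ} (s : ℕ) (hq : 0 < q) (hk : 1 ≤ k) :
    ∃ (V I : Type) (_ : Fintype V) (_ : Fintype I) (ρ : I → Fin k → V),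
      (∀ i, Function.Injective (ρ i)) ∧ HasLeaves s ρ ∧
      ∀ χ : V → Fin q, ∃ i γ, ∀ a, χ (ρ i a) = γ := by
  obtain ⟨V, I, _, _, E, hcard, hE, hU⟩ := hasSparseUnavoidable q s hq k hk
  let e : ∀ i, Fin k ≃ E i := fun i => ((E i).equivFinOfCardEq (hcard i)).symm
  refine ⟨V, I, inferInstance, inferInstance, fun i a => (e i a).1,
    fun i => Subtype.val_injective.comp (e i).injective, ?_, ?_⟩
  · intro J hJ hJs
    obtain ⟨i, hi, h⟩ := hE.exists_leaf J hJ hJs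
    refine ⟨i, hi, ?_⟩
    rintro a b ⟨j, hj, hji, c, hc⟩ ⟨j', hj', hji', c', hc'⟩
    have hc : (e j c).1 = (e i a).1 := hc
    have hc' : (e j' c').1 = (e i b).1 := hc'
    exact (e i).injective (Subtype.ext (h _ (e i a).2 _ (e i b).2
      ⟨j, hj, hji, hc ▸ (e j c).2⟩ ⟨j', hj', hji', hc' ▸ (e j' c').2⟩))
  · intro χ
    obtain ⟨i, γ, h⟩ := hU χ
    exact ⟨i, γ, fun a => h _ (e i a).2⟩

/-- Deleting at most two vertices leaves a nonempty connected graph. -/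
def RemovalConnected {W : Type} (F : SimpleGraph W) : Prop :=
  ∀ S : Finset W, S.card ≤ 2 → (F.induce ((↑S : Set W)ᶜ)).Connected

theorem ThreeConnOrK3.removalConnected {W : Type} [Fintype W] {F : SimpleGraph W}
    (hF : ThreeConnOrK3 F) : RemovalConnected F := by
  classical
  rcases hF with h | ⟨⟨e⟩⟩
  · exact h.2
  intro S hS
  have hcard : Fintype.card W = 3 := by simpa using Fintype.card_congr e.toEquiv
  have hadj : ∀ a b, a ≠ b → F.Adj a b := fun a b hab => by
    rw [← e.map_adj_iff]
    simpa using hab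
  have : ∃ x, x ∉ S := by
    by_contra! h
    have := Finset.card_le_card (fun x _ => h x : (Finset.univ : Finset W) ⊆ S)
    rw [Finset.card_univ] at this
    omega
  obtain ⟨x, hx⟩ := this
  have : Nonempty ((↑S : Set W)ᶜ : Set W) := ⟨⟨x, by simpa using hx⟩⟩
  refine ⟨fun a b => ?_⟩
  by_cases hab : a = b
  · exact hab ▸ Reachable.refl _
  · exact (show (F.induce _).Adj a b from hadj _ _ fun h => hab (Subtype.ext h)).reachable

theorem RemovalConnected.exists_not_mem {W : Type} {F : SimpleGraph W} (hF : RemovalConnected F)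
    (S : Finset W) (hS : S.card ≤ 2) : ∃ w, w ∉ S := by
  obtain ⟨⟨w, hw⟩⟩ := (hF S hS).nonempty
  exact ⟨w, by simpa using hw⟩

/-- Every vertex has a neighbour different from any given vertex. -/
theorem RemovalConnected.exists_adj_ne {W : Type} {F : SimpleGraph W} (hF : RemovalConnected F)
    (w u : W) : ∃ w', F.Adj w w' ∧ w' ≠ u := by
  classical
  obtain rfl | hwu := eq_or_ne w u
  · obtain ⟨z, hz⟩ := hF.exists_not_mem {w} (by simp)
    have hz : z ≠ w := by simpa using hz
    have hc := (hF ∅ (by simp)).preconnected ⟨w, by simp⟩ ⟨z, by simp⟩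
    obtain ⟨p⟩ := hc
    obtain ⟨y, hy⟩ : ∃ y, (F.induce _).Adj ⟨w, _⟩ y := by
      cases p with
      | nil => exact absurd rfl hz
      | cons h _ => exact ⟨_, h⟩
    exact ⟨y, hy, fun h => F.ne_of_adj hy h.symm⟩
  · obtain ⟨z, hz⟩ := hF.exists_not_mem {w, u} Finset.card_le_two
    have hz : z ≠ w ∧ z ≠ u := by simpa using hz
    have hc := (hF {u} (by simp)).preconnected ⟨w, by simpa using hwu⟩ ⟨z, by simpa using hz.2⟩
    obtain ⟨p⟩ := hc
    obtain ⟨y, hy⟩ : ∃ y, (F.induce _).Adj ⟨w, _⟩ y := by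
      cases p with
      | nil => exact absurd rfl hz.1
      | cons h _ => exact ⟨_, h⟩
    exact ⟨y, hy, by simpa using y.2⟩

/-- A set of vertices of `F` closed under adjacency outside a set of at most two vertices is empty
or everything there. -/
theorem RemovalConnected.all_or_none {W : Type} {F : SimpleGraph W} (hF : RemovalConnected F)
    (S : Finset W) (hS : S.card ≤ 2) (p : W → Prop)
    (hp : ∀ a b, a ∉ S → b ∉ S → F.Adj a b → p a → p b) :
    (∀ a, a ∉ S → p a) ∨ ∀ a, a ∉ S → ¬ p a := by
  by_contra! h
  obtain ⟨⟨a, ha, hpa⟩, b, hb, hpb⟩ := h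
  obtain ⟨w⟩ := (hF S hS).preconnected ⟨b, by simpa using hb⟩ ⟨a, by simpa using ha⟩
  have : ∀ (x y : ((↑S : Set W)ᶜ : Set W)), (F.induce ((↑S : Set W)ᶜ)).Walk x y → p x → p y := by
    intro x y w
    induction w with
    | nil => exact id
    | @cons x y _ h _ ih => exact fun hx => ih (hp x y x.2 y.2 h hx)
  exact hpa (this _ _ w hpb)

/-- Suppose that a graph is covered by pieces sharing a vertex `v`, and that the pieces are
arranged in a locally tree-like fashion away from `v`. Then every small subgraph that stays
connected on removing two vertices lies in a single piece. -/
theorem RemovalConnected.exists_piece {I U W : Type} [Fintype W] {F : SimpleGraph W}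
    (hF : RemovalConnected F) {s : ℕ} (hs : Fintype.card (W × W) ≤ s) (X : I → Set U) (v : U)
    (leaf : ∀ J : Finset I, J.Nonempty → J.card ≤ s → ∃ i ∈ J, ∀ x ∈ X i, ∀ y ∈ X i,
      x ≠ v → y ≠ v → (∃ j ∈ J, j ≠ i ∧ x ∈ X j) → (∃ j ∈ J, j ≠ i ∧ y ∈ X j) → x = y)
    (g : W ↪ U) (hg : ∀ a b, F.Adj a b → ∃ i, g a ∈ X i ∧ g b ∈ X i) :
    ∃ i, ∀ w, g w = v ∨ g w ∈ X i := by
  classical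
  have key : ∀ (n : ℕ) (J : Finset I), J.card = n → J.card ≤ s →
      (∀ a b, F.Adj a b → g a ≠ v → g b ≠ v → ∃ i ∈ J, g a ∈ X i ∧ g b ∈ X i) →
      ∃ i, ∀ w, g w = v ∨ g w ∈ X i := by
    intro n
    induction n with
    | zero =>
      intro J hJ _ hcov
      obtain rfl := Finset.card_eq_zero.1 hJ
      obtain ⟨u, hu⟩ : ∃ u, ∀ w, g w = v → w = u := by
        by_cases h : ∃ u, g u = v
        · obtain ⟨u, hu⟩ := h
          exact ⟨u, fun w hw => g.injective (hw.trans hu.symm)⟩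
        · push Not at h
          obtain ⟨w, _⟩ := hF.exists_not_mem ∅ (by simp)
          exact ⟨w, fun w hw => absurd hw (h w)⟩
      obtain ⟨a, ha⟩ := hF.exists_not_mem {u} (by simp)
      obtain ⟨b, hab, hb⟩ := hF.exists_adj_ne a u
      obtain ⟨i, hi, -⟩ := hcov a b hab (fun h => by simp [hu a h] at ha) fun h => hb (hu b h)
      simp at hi
    | succ n ih =>
      intro J hJ hJs hcov
      obtain ⟨i, hi, hleaf⟩ := leaf J (Finset.card_pos.1 (by omega)) hJs
      let T : W → Prop := fun w => g w ≠ v ∧ g w ∈ X i ∧ ∃ j ∈ J, j ≠ i ∧ g w ∈ X j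
      have hT : ∀ a b, T a → T b → a = b := fun a b ha hb =>
        g.injective (hleaf _ ha.2.1 _ hb.2.1 ha.1 hb.1 ha.2.2 hb.2.2)
      let S₁ : Finset W := Finset.univ.filter fun w => g w = v
      let S₂ : Finset W := Finset.univ.filter T
      have hS : (S₁ ∪ S₂).card ≤ 2 := by
        have h1 : S₁.card ≤ 1 := Finset.card_le_one.2 fun a ha b hb =>
          g.injective ((Finset.mem_filter.1 ha).2.trans (Finset.mem_filter.1 hb).2.symm)
        have h2 : S₂.card ≤ 1 := Finset.card_le_one.2 fun a ha b hb =>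
          hT a b (Finset.mem_filter.1 ha).2 (Finset.mem_filter.1 hb).2
        have := Finset.card_union_le S₁ S₂
        omega
      have hmem : ∀ w, w ∉ S₁ ∪ S₂ ↔ g w ≠ v ∧ ¬ T w := by
        intro w
        simp [S₁, S₂]
      rcases hF.all_or_none (S₁ ∪ S₂) hS (fun w => g w ∈ X i) (by
        intro a b ha hb hab hai
        rw [hmem] at ha hb
        obtain ⟨j, hj, haj, hbj⟩ := hcov a b hab ha.1 hb.1
        by_cases hji : j = i
        · exact hji ▸ hbj
        · exact absurd ⟨ha.1, hai, j, hj, hji, haj⟩ ha.2) with hall | hnone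
      · refine ⟨i, fun w => ?_⟩
        by_cases hw : g w = v
        · exact Or.inl hw
        · by_cases hTw : T w
          · exact Or.inr hTw.2.1
          · exact Or.inr (hall w ((hmem w).2 ⟨hw, hTw⟩))
      · refine ih (J.erase i) (by rw [Finset.card_erase_of_mem hi]; omega)
          ((Finset.card_erase_le).trans hJs) fun a b hab ha hb => ?_
        obtain ⟨j, hj, haj, hbj⟩ := hcov a b hab ha hb
        refine ⟨j, Finset.mem_erase.2 ⟨?_, hj⟩, haj, hbj⟩
        rintro rfl
        have hTa : T a := by
          by_contra h
          exact hnone a ((hmem a).2 ⟨ha, h⟩) haj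
        have hTb : T b := by
          by_contra h
          exact hnone b ((hmem b).2 ⟨hb, h⟩) hbj
        exact hab.ne (hT a b hTa hTb)
  choose m hm using hg
  let J : Finset I := Finset.univ.image fun e : {e : W × W // F.Adj e.1 e.2} => m e.1.1 e.1.2 e.2
  have hJ : J.card ≤ s := Finset.card_image_le.trans
    ((Finset.card_univ.trans_le (Fintype.card_subtype_le _)).trans hs)
  exact key _ J rfl hJ fun a b hab _ _ =>
    ⟨m a b hab, Finset.mem_image.2 ⟨⟨(a, b), hab⟩, Finset.mem_univ _, rfl⟩, hm a b hab⟩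

/-- A graph with a vertex `center` and `k` distinguished neighbours of it. -/
structure StarGraph (k : ℕ) (A : Type) where
  graph : SimpleGraph A
  center : A
  root : Fin k ↪ A
  adj : ∀ a, graph.Adj center (root a)

open Classical in
/-- The map placing the `i`-th piece into the common vertex set of an amalgam: all the centers are
identified, and so are roots carrying the same label in `V`. -/
noncomputable def StarGraph.place {I V : Type} {k : ℕ} {A : I → Type}
    (P : ∀ i, StarGraph k (A i)) (ρ : I → Fin k → V) (i : I) (a : A i) :
    Option V ⊕ Σ i, A i :=
  if a = (P i).center then Sum.inl none
  else if h : ∃ m, (P i).root m = a then Sum.inl (some (ρ i h.choose))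
  else Sum.inr ⟨i, a⟩

namespace StarGraph

variable {I V : Type} {k : ℕ} {A : I → Type} (P : ∀ i, StarGraph k (A i)) (ρ : I → Fin k → V)

theorem place_center (i : I) : place P ρ i (P i).center = Sum.inl none := by
  simp [place]

theorem place_root (i : I) (m : Fin k) :
    place P ρ i ((P i).root m) = Sum.inl (some (ρ i m)) := by
  have h : ∃ m', (P i).root m' = (P i).root m := ⟨m, rfl⟩
  have hm : h.choose = m := (P i).root.injective h.choose_spec
  rw [place, if_neg ((P i).adj m).ne', dif_pos h, hm]

theorem place_cases (i : I) (a : A i) :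
    a = (P i).center ∨ (∃ m, a = (P i).root m) ∨ place P ρ i a = Sum.inr ⟨i, a⟩ := by
  by_cases h : a = (P i).center
  · exact Or.inl h
  · by_cases h' : ∃ m, (P i).root m = a
    · exact Or.inr (Or.inl (h'.imp fun _ => Eq.symm))
    · exact Or.inr (Or.inr (by rw [place, if_neg h, dif_neg h']))

theorem place_eq_place {i j : I} {a : A i} {b : A j} (h : place P ρ i a = place P ρ j b) :
    (a = (P i).center ∧ b = (P j).center) ∨
      (∃ m n, a = (P i).root m ∧ b = (P j).root n ∧ ρ i m = ρ j n) ∨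
      (⟨i, a⟩ : Σ i, A i) = ⟨j, b⟩ := by
  rcases place_cases P ρ i a with rfl | ⟨m, rfl⟩ | ha <;>
    rcases place_cases P ρ j b with rfl | ⟨n, rfl⟩ | hb
  · exact Or.inl ⟨rfl, rfl⟩
  · simp [place_center, place_root] at h
  · simp [place_center, hb] at h
  · simp [place_center, place_root] at h
  · exact Or.inr (Or.inl ⟨m, n, rfl, rfl, by simpa [place_root] using h⟩)
  · simp [place_root, hb] at h
  · simp [place_center, ha] at h
  · simp [place_root, ha] at h
  · exact Or.inr (Or.inr (by rwa [ha, hb, Sum.inr.injEq] at h))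

theorem place_injective {i : I} (hρ : Function.Injective (ρ i)) :
    Function.Injective (place P ρ i) := by
  intro a b h
  rcases place_eq_place P ρ h with ⟨rfl, rfl⟩ | ⟨m, n, rfl, rfl, hmn⟩ | h
  · rfl
  · rw [hρ hmn]
  · simpa using h

theorem place_adj {s : ℕ} (hs : 2 ≤ s) (hρ : ∀ i, Function.Injective (ρ i)) (leaf : HasLeaves s ρ)
    {i j : I} {a b : A i} {a' b' : A j} (ha : place P ρ i a = place P ρ j a')
    (hb : place P ρ i b = place P ρ j b') (hadj : (P j).graph.Adj a' b') :
    (P i).graph.Adj a b ∧ ∀ (q : ℕ) (χ : V → Fin q) (c : ∀ i, Sym2 (A i) → Fin q),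
      (∀ i a, c i s((P i).center, (P i).root a) = χ (ρ i a)) → c i s(a, b) = c j s(a', b') := by
  classical
  obtain rfl | hij := eq_or_ne i j
  · obtain rfl := place_injective P ρ (hρ i) ha
    obtain rfl := place_injective P ρ (hρ i) hb
    exact ⟨hadj, fun _ _ _ _ => rfl⟩
  · rcases place_eq_place P ρ ha with ⟨rfl, rfl⟩ | ⟨m, n, rfl, rfl, hmn⟩ | h <;>
      rcases place_eq_place P ρ hb with ⟨rfl, rfl⟩ | ⟨m', n', rfl, rfl, hmn'⟩ | h'
    · exact absurd rfl hadj.ne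
    · exact ⟨(P i).adj m', fun q χ c hc => by rw [hc, hc, hmn']⟩
    · exact absurd (congrArg Sigma.fst h') hij
    · exact ⟨((P i).adj m).symm, fun q χ c hc => by rw [Sym2.eq_swap, hc, Sym2.eq_swap, hc, hmn]⟩
    · exfalso
      have hn : n ≠ n' := fun h => hadj.ne (by rw [h])
      have hm : m ≠ m' := fun h => hn (hρ j (by rw [← hmn, ← hmn', h]))
      obtain ⟨l, hl, hleaf⟩ := leaf {i, j} (by simp) (Finset.card_le_two.trans hs)
      rcases Finset.mem_insert.1 hl with rfl | hl
      · exact hm (hleaf m m' ⟨j, by simp, hij.symm, n, hmn.symm⟩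
          ⟨j, by simp, hij.symm, n', hmn'.symm⟩)
      · obtain rfl := Finset.mem_singleton.1 hl
        exact hn (hleaf n n' ⟨i, by simp, hij, m, hmn⟩ ⟨i, by simp, hij, m', hmn'⟩)
    all_goals first
      | exact absurd (congrArg Sigma.fst h') hij
      | exact absurd (congrArg Sigma.fst h) hij

/-- Pieces can be glued along their centers and along their roots in a locally tree-like
pattern `ρ`, such that colourings of the pieces without a monochromatic copy of a given small
highly connected graph which agree on the glued edges combine to a colouring of the whole
graph without such a copy. -/
theorem exists_amalgam [Fintype I] [Fintype V] [∀ i, Fintype (A i)] {s q : ℕ} (hq : 0 < q)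
    (hs : 2 ≤ s) (hρ : ∀ i, Function.Injective (ρ i)) (leaf : HasLeaves s ρ) :
    ∃ (U : Type) (_ : Fintype U) (G : SimpleGraph U) (v : U) (r : V ↪ U) (f : ∀ i, A i ↪ U),
      (∀ i a b, (P i).graph.Adj a b → G.Adj (f i a) (f i b)) ∧
      (∀ i, f i (P i).center = v) ∧ (∀ i a, f i ((P i).root a) = r (ρ i a)) ∧
      ∀ {W : Type} [Fintype W] (F : SimpleGraph W), RemovalConnected F →
        Fintype.card (W × W) ≤ s → ∀ (χ : V → Fin q) (c : ∀ i, Sym2 (A i) → Fin q),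
        (∀ i, ¬ HasMonoCopy (P i).graph F (c i)) →
        (∀ i a, c i s((P i).center, (P i).root a) = χ (ρ i a)) →
        ∃ c' : Sym2 U → Fin q, ¬ HasMonoCopy G F c' ∧
          ∀ i a b, (P i).graph.Adj a b → c' s(f i a, f i b) = c i s(a, b) := by
  classical
  let f : ∀ i, A i ↪ Option V ⊕ Σ i, A i := fun i => ⟨place P ρ i, place_injective P ρ (hρ i)⟩
  let G : SimpleGraph (Option V ⊕ Σ i, A i) :=
    { Adj := fun x y => ∃ i a b, (P i).graph.Adj a b ∧ f i a = x ∧ f i b = y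
      symm := ⟨fun _ _ ⟨i, a, b, h, ha, hb⟩ => ⟨i, b, a, h.symm, hb, ha⟩⟩
      loopless := ⟨fun _ ⟨i, a, b, h, ha, hb⟩ => h.ne ((f i).injective (ha.trans hb.symm))⟩ }
  refine ⟨_, inferInstance, G, Sum.inl none,
    ⟨fun x => Sum.inl (some x), fun x y h => by simpa using h⟩, f,
    fun i a b h => ⟨i, a, b, h, rfl, rfl⟩, place_center P ρ, place_root P ρ, ?_⟩
  intro W _ F hF hW χ c hfree hc
  let c' : Sym2 (Option V ⊕ Σ i, A i) → Fin q := fun e =>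
    if h : ∃ i : I, ∃ a b, (P i).graph.Adj a b ∧ s(f i a, f i b) = e then
      c h.choose s(h.choose_spec.choose, h.choose_spec.choose_spec.choose) else ⟨0, hq⟩
  have hc' : ∀ i a b, (P i).graph.Adj a b → c' s(f i a, f i b) = c i s(a, b) := by
    intro i a b hab
    have h : ∃ j : I, ∃ a' b', (P j).graph.Adj a' b' ∧ s(f j a', f j b') = s(f i a, f i b) :=
      ⟨i, a, b, hab, rfl⟩
    simp only [c', dif_pos h]
    have hsp := h.choose_spec.choose_spec.choose_spec.2
    rcases Sym2.eq_iff.1 hsp with ⟨h1, h2⟩ | ⟨h1, h2⟩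
    · exact (place_adj P ρ hs hρ leaf h1 h2 hab).2 q χ c hc
    · rw [Sym2.eq_swap (a := a)]
      exact (place_adj P ρ hs hρ leaf h1 h2 hab.symm).2 q χ c hc
  refine ⟨c', ?_, hc'⟩
  rintro ⟨γ, g, hg⟩
  obtain ⟨i, hi⟩ := hF.exists_piece hW (fun i => Set.range (f i)) (Sum.inl none) (by
    intro J hJ hJs
    obtain ⟨i, hi, hleaf⟩ := leaf J hJ hJs
    refine ⟨i, hi, ?_⟩
    rintro _ ⟨x, rfl⟩ _ ⟨y, rfl⟩ hx hy ⟨j, hj, hji, x', hx'⟩ ⟨l, hl, hli, y', hy'⟩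
    have key : ∀ (j : I) (x' : A j) (x : A i), f i x ≠ Sum.inl none → j ≠ i → f j x' = f i x →
        ∃ m n, x = (P i).root m ∧ ρ j n = ρ i m := by
      intro j x' x hx hji h
      rcases place_eq_place P ρ h with ⟨-, rfl⟩ | ⟨n, m, -, rfl, hnm⟩ | h
      · exact absurd (place_center P ρ i) hx
      · exact ⟨m, n, rfl, hnm⟩
      · exact absurd (congrArg Sigma.fst h) hji
    obtain ⟨m, n, rfl, hmn⟩ := key j x' x hx hji hx'
    obtain ⟨m', n', rfl, hmn'⟩ := key l y' y hy hli hy'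
    rw [hleaf m m' ⟨j, hj, hji, n, hmn⟩ ⟨l, hl, hli, n', hmn'⟩]) g (fun a b hab => by
      obtain ⟨i, x, y, -, hx, hy⟩ := (hg a b hab).1
      exact ⟨i, ⟨x, hx⟩, ⟨y, hy⟩⟩)
  have hi' : ∀ w, ∃ x, f i x = g w := fun w =>
    (hi w).elim (fun h => ⟨_, (place_center P ρ i).trans h.symm⟩) id
  choose g' hg' using hi'
  refine hfree i ⟨γ, ⟨g', fun a b h => g.injective (by rw [← hg', ← hg', h])⟩, fun a b hab => ?_⟩
  obtain ⟨⟨j, x, y, hxy, hx, hy⟩, hγ⟩ := hg a b hab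
  have h := (place_adj P ρ hs hρ leaf ((hg' a).trans hx.symm) ((hg' b).trans hy.symm) hxy).1
  refine ⟨h, ?_⟩
  rw [← hγ, ← hg', ← hg', hc' _ _ _ h]
  rfl

end StarGraph

theorem HasMonoCopy.map {U V W : Type} {G : SimpleGraph U} {G' : SimpleGraph V}
    {F : SimpleGraph W} {q : ℕ} (f : U ↪ V) (hf : ∀ a b, G.Adj a b → G'.Adj (f a) (f b))
    {c : Sym2 U → Fin q} {c' : Sym2 V → Fin q}
    (hc : ∀ a b, G.Adj a b → c' s(f a, f b) = c s(a, b)) (h : HasMonoCopy G F c) :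
    HasMonoCopy G' F c' := by
  obtain ⟨γ, g, hg⟩ := h
  exact ⟨γ, g.trans f, fun a b hab =>
    ⟨hf _ _ (hg a b hab).1, (hc _ _ (hg a b hab).1).trans (hg a b hab).2⟩⟩

theorem IsRamsey.map {U V W : Type} {G : SimpleGraph U} {G' : SimpleGraph V}
    {F : SimpleGraph W} {q : ℕ} (h : IsRamsey q G F) (f : U ↪ V)
    (hf : ∀ a b, G.Adj a b → G'.Adj (f a) (f b)) : IsRamsey q G' F := fun c =>
  (h (c ∘ Sym2.map f)).map f hf fun _ _ _ => rfl

theorem hasMonoCopy_perm {V W : Type} {G : SimpleGraph V} {F : SimpleGraph W} {q : ℕ}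
    (σ : Equiv.Perm (Fin q)) {c : Sym2 V → Fin q} (h : HasMonoCopy G F (σ ∘ c)) :
    HasMonoCopy G F c := by
  obtain ⟨γ, g, hg⟩ := h
  exact ⟨σ.symm γ, g, fun a b hab =>
    ⟨(hg a b hab).1, (Equiv.eq_symm_apply σ).2 (hg a b hab).2⟩⟩

theorem exists_prehomogeneous (q : ℕ) (hq : 0 < q) (m : ℕ) : ∃ N, ∀ {V : Type} (c : Sym2 V → Fin q)
    (S : Finset V), N ≤ S.card → ∃ (x : Fin m ↪ V) (κ : Fin m → Fin q),
      (∀ i, x i ∈ S) ∧ ∀ i j, i < j → c s(x i, x j) = κ i := by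
  classical
  induction m with
  | zero => exact ⟨0, fun _ _ _ => ⟨⟨Fin.elim0, fun i => i.elim0⟩, Fin.elim0, fun i => i.elim0,
      fun i => i.elim0⟩⟩
  | succ m ih =>
    obtain ⟨N, hN⟩ := ih
    refine ⟨q * N + 1, fun {V} c S hS => ?_⟩
    obtain ⟨v, hv⟩ : S.Nonempty := Finset.card_pos.1 (by omega)
    obtain ⟨γ, -, hγ⟩ := Finset.exists_le_card_fiber_of_mul_le_card_of_maps_to
      (s := S.erase v) (t := Finset.univ) (f := fun y => c s(v, y)) (n := N)
      (fun _ _ => Finset.mem_univ _) ⟨⟨0, hq⟩, Finset.mem_univ _⟩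
      (by rw [Finset.card_erase_of_mem hv, Finset.card_univ, Fintype.card_fin]; omega)
    obtain ⟨x, κ, hx, hκ⟩ := hN c _ hγ
    simp only [Finset.mem_filter, Finset.mem_erase] at hx
    refine ⟨⟨Fin.cons v x, Fin.cons_injective_iff.2 ⟨?_, x.injective⟩⟩, Fin.cons γ κ, ?_, ?_⟩
    · rintro ⟨i, hi⟩
      exact (hx i).1.1 hi
    · intro i
      refine Fin.cases hv (fun i => (hx i).1.2) i
    · intro i j
      refine Fin.cases (fun h => ?_) (fun j h => ?_) j
      · exact absurd h (Fin.not_lt_zero _)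
      · revert h
        refine Fin.cases (fun _ => (hx j).2) (fun i h => hκ i j (Fin.succ_lt_succ_iff.1 h)) i

/-- Ramsey's theorem. -/
theorem exists_isRamsey_top {W : Type} [Fintype W] (F : SimpleGraph W) {q : ℕ} (hq : 0 < q) :
    ∃ N, IsRamsey q (⊤ : SimpleGraph (Fin N)) F := by
  obtain ⟨N, hN⟩ := exists_prehomogeneous q hq (q * (Fintype.card W - 1) + 1)
  refine ⟨N, fun c => ?_⟩
  obtain ⟨x, κ, -, hκ⟩ := hN c Finset.univ (by simp)
  obtain ⟨K, γ, hK, hγ⟩ := exists_card_eq_of_coloring κ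
  let e : W ≃ K := (Fintype.equivFin W).trans (K.equivFinOfCardEq hK).symm
  let g : W ↪ Fin N := (e.toEmbedding.trans (Function.Embedding.subtype _)).trans x
  refine ⟨γ, g, fun a b hab => ⟨fun h => hab.ne (g.injective h), ?_⟩⟩
  have hne : (e a).1 ≠ (e b).1 := fun h => hab.ne (e.injective (Subtype.ext h))
  rcases lt_or_gt_of_ne hne with h | h
  · exact (hκ _ _ h).trans (hγ _ (e a).2)
  · exact (congrArg c Sym2.eq_swap).trans ((hκ _ _ h).trans (hγ _ (e b).2))

theorem exists_nonconstant_star {W : Type} [Fintype W] {F : SimpleGraph W}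
    (hF : RemovalConnected F) {q : ℕ} (hq : 2 ≤ q) :
    ∃ (A : Type) (_ : Fintype A) (k : ℕ) (P : StarGraph k A),
      (∃ c : Sym2 A → Fin q, ¬ HasMonoCopy P.graph F c) ∧
      ∀ c : Sym2 A → Fin q, ¬ HasMonoCopy P.graph F c →
        ∀ γ, ∃ a, c s(P.center, P.root a) ≠ γ := by
  classical
  obtain ⟨N, hN⟩ := exists_isRamsey_top F (q := q) (by omega)
  obtain ⟨G, hG⟩ := (Set.toFinite {G : SimpleGraph (Fin N) | IsRamsey q G F}).exists_minimal
    ⟨⊤, hN⟩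
  obtain ⟨v, u, hvu⟩ : ∃ v u, G.Adj v u := by
    obtain ⟨_, g, hg⟩ := hG.1 fun _ => ⟨0, by omega⟩
    obtain ⟨w, -⟩ := hF.exists_not_mem ∅ (by simp)
    obtain ⟨w', hw, -⟩ := hF.exists_adj_ne w w
    exact ⟨_, _, (hg w w' hw).1⟩
  let P := G.deleteEdges {s(v, u)}
  have hP : ¬ IsRamsey q P F := fun h =>
    absurd (hG.2 h (G.deleteEdges_le _) hvu) (by simp [P])
  let e : Fin (Fintype.card (P.neighborSet v)) ↪ Fin N :=
    (Fintype.equivFin (P.neighborSet v)).symm.toEmbedding.trans (Function.Embedding.subtype _)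
  refine ⟨Fin N, inferInstance, _,
    ⟨P, v, e, fun a => ((Fintype.equivFin (P.neighborSet v)).symm a).2⟩,
    by simpa [IsRamsey] using hP, fun c hc γ => ?_⟩
  by_contra! hγ
  have hv : ∀ y, P.Adj v y → c s(v, y) = γ := by
    intro y hy
    have := hγ (Fintype.equivFin (P.neighborSet v) ⟨y, hy⟩)
    simpa [e] using this
  have : Nontrivial (Fin q) := Fin.nontrivial_iff_two_le.2 hq
  obtain ⟨γ', hγ'⟩ := exists_ne γ
  obtain ⟨δ, g, hg⟩ := hG.1 (Function.update c s(v, u) γ')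
  have key : ∀ a b, F.Adj a b → g a = v → g b = u → False := by
    intro a b hab ha hb
    obtain ⟨b', hab', hbb'⟩ := hF.exists_adj_ne a b
    have h1 := (hg a b hab).2
    have h2 := hg a b' hab'
    rw [ha] at h1 h2
    rw [hb, Function.update_self] at h1
    have hne : s(v, g b') ≠ s(v, u) := by
      rw [Ne, Sym2.congr_right, ← hb]
      exact fun h => hbb' (g.injective h)
    rw [Function.update_of_ne hne, hv _ (by simp [P, h2.1, hne])] at h2
    exact hγ' (h1.trans h2.2.symm)
  refine hc ⟨δ, g, fun a b hab => ?_⟩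
  have hne : s(g a, g b) ≠ s(v, u) := by
    intro h
    rcases Sym2.eq_iff.1 h with ⟨ha, hb⟩ | ⟨ha, hb⟩
    · exact key a b hab ha hb
    · exact key b a hab.symm hb ha
  have h := hg a b hab
  rw [Function.update_of_ne hne] at h
  exact ⟨by rw [deleteEdges_adj]; exact ⟨h.1, hne⟩, h.2⟩

/-- There is a graph with two distinguished edges at a vertex which has a colouring without
monochromatic copy of `F`, and in which every such colouring separates the two edges. -/
theorem exists_distinct_gadget {W : Type} [Fintype W] {F : SimpleGraph W}
    (hF : RemovalConnected F) {q s : ℕ} (hq : 2 ≤ q) (hs : 2 ≤ s)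
    (hW : Fintype.card (W × W) ≤ s) :
    ∃ (A : Type) (_ : Fintype A) (Q : StarGraph 2 A),
      (∃ c : Sym2 A → Fin q, ¬ HasMonoCopy Q.graph F c) ∧
      ∀ c : Sym2 A → Fin q, ¬ HasMonoCopy Q.graph F c →
        c s(Q.center, Q.root 0) ≠ c s(Q.center, Q.root 1) := by
  classical
  have hq0 : 0 < q := by omega
  obtain ⟨B, _, k, P, ⟨c₀, hc₀⟩, hP⟩ := exists_nonconstant_star hF hq
  have hk : 1 ≤ k := by
    obtain ⟨a, -⟩ := hP c₀ hc₀ ⟨0, hq0⟩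
    exact a.pos
  obtain ⟨V, I, _, _, ρ, hρ, hleaf, hU⟩ := exists_system_hasLeaves s hq0 hk
  let Sat : Setoid (I × Fin k) → Prop := fun r => ∃ χ : I × Fin k → Fin q, r ≤ Setoid.ker χ ∧
    ∀ i, ∃ c : Sym2 B → Fin q, ¬ HasMonoCopy P.graph F c ∧
      ∀ a, c s(P.center, P.root a) = χ (i, a)
  let K : Setoid (I × Fin k) := Setoid.ker fun p => ρ p.1 p.2
  have : Finite (Setoid (I × Fin k)) :=
    Finite.of_injective (fun r : Setoid (I × Fin k) => r.r) fun _ _ h =>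
      Setoid.ext fun a b => iff_of_eq (congrFun (congrFun h a) b)
  obtain ⟨r, ⟨hrK, χ, hrχ, hχ⟩, hmax⟩ := (Set.toFinite {r | r ≤ K ∧ Sat r}).exists_maximal
    ⟨⊥, bot_le, fun p => c₀ s(P.center, P.root p.2), bot_le, fun _ => ⟨c₀, hc₀, fun _ => rfl⟩⟩
  obtain ⟨x, y, hxyK, hxyr⟩ : ∃ x y, K x y ∧ ¬ r x y := by
    by_contra! hcon
    let χ' : V → Fin q := fun z =>
      if h : ∃ p : I × Fin k, ρ p.1 p.2 = z then χ h.choose else ⟨0, hq0⟩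
    have hχ' : ∀ i a, χ' (ρ i a) = χ (i, a) := by
      intro i a
      have h : ∃ p : I × Fin k, ρ p.1 p.2 = ρ i a := ⟨(i, a), rfl⟩
      simp only [χ', dif_pos h]
      exact hrχ (hcon _ _ h.choose_spec)
    obtain ⟨i, γ, hi⟩ := hU χ'
    obtain ⟨c, hc, hcχ⟩ := hχ i
    obtain ⟨a, ha⟩ := hP c hc γ
    exact ha (by rw [hcχ, ← hχ', hi])
  have : Fintype (Quotient r) := Fintype.ofFinite _
  let ρ' : I → Fin k → Quotient r := fun i a => Quotient.mk r (i, a)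
  have hρ' : ∀ i j a b, ρ' i a = ρ' j b → ρ i a = ρ j b := fun i j a b h =>
    hrK (Quotient.exact h)
  have hleaf' : HasLeaves s ρ' := by
    intro J hJ hJs
    obtain ⟨i, hi, h⟩ := hleaf J hJ hJs
    refine ⟨i, hi, ?_⟩
    rintro a b ⟨j, hj, hji, m, hm⟩ ⟨j', hj', hji', m', hm'⟩
    exact h a b ⟨j, hj, hji, m, hρ' _ _ _ _ hm⟩ ⟨j', hj', hji', m', hρ' _ _ _ _ hm'⟩
  obtain ⟨U, _, G, v, t, f, hadj, hcen, hroot, hext⟩ := StarGraph.exists_amalgam (fun _ : I => P) ρ'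
    hq0 hs (fun i a b h => hρ i (hρ' _ _ _ _ h)) hleaf'
  have hvt : ∀ p : I × Fin k, G.Adj v (t (Quotient.mk r p)) := fun p => by
    have h := hadj p.1 _ _ (P.adj p.2)
    rwa [hcen, hroot] at h
  have hne : t (Quotient.mk r x) ≠ t (Quotient.mk r y) := fun h =>
    hxyr (Quotient.exact (t.injective h))
  refine ⟨U, inferInstance, ⟨G, v, ⟨![t (Quotient.mk r x), t (Quotient.mk r y)], ?_⟩, ?_⟩, ?_, ?_⟩
  · intro a b h
    fin_cases a <;> fin_cases b <;> first | rfl | exact absurd h hne | exact absurd h.symm hne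
  · intro a
    fin_cases a
    · exact hvt x
    · exact hvt y
  · choose c hc hcχ using hχ
    obtain ⟨c', hc', -⟩ := hext F hF hW (Quotient.lift χ fun _ _ h => hrχ h) c hc hcχ
    exact ⟨c', hc'⟩
  · intro c hc heq
    have heq : c s(v, t (Quotient.mk r x)) = c s(v, t (Quotient.mk r y)) := heq
    let χ₁ : I × Fin k → Fin q := fun p => c s(v, t (Quotient.mk r p))
    have hrχ₁ : r ≤ Setoid.ker χ₁ := fun p p' h => by
      change c s(v, t _) = c s(v, t _)
      rw [Quotient.sound h]
    have hsat : Sat (Setoid.ker χ₁ ⊓ K) := by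
      refine ⟨χ₁, inf_le_left, fun i => ⟨c ∘ Sym2.map (f i), fun h => hc ?_, fun a => ?_⟩⟩
      · exact h.map (f i) (hadj i) fun _ _ _ => rfl
      · simp only [Function.comp, Sym2.map_mk, χ₁]
        rw [← hcen i, hroot i]
    exact hxyr (hmax ⟨inf_le_right, hsat⟩ (le_inf hrχ₁ hrK) ⟨heq, hxyK⟩)

theorem HasLeaves.comp {V I J : Type} {k s : ℕ} {ρ : I → Fin k → V} (h : HasLeaves s ρ)
    (φ : J ↪ I) : HasLeaves s (ρ ∘ φ) := by
  classical
  intro K hK hKs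
  obtain ⟨i, hi, hleaf⟩ := h (K.map φ) (by simpa using hK) (by simpa using hKs)
  obtain ⟨i, hiK, rfl⟩ := Finset.mem_map.1 hi
  refine ⟨i, hiK, ?_⟩
  rintro a b ⟨j, hj, hji, m, hm⟩ ⟨j', hj', hji', m', hm'⟩
  exact hleaf a b ⟨φ j, Finset.mem_map_of_mem _ hj, φ.injective.ne hji, m, hm⟩
    ⟨φ j', Finset.mem_map_of_mem _ hj', φ.injective.ne hji', m', hm'⟩

theorem StarGraph.exists_coloring_of_ne {A W : Type} {F : SimpleGraph W} {q : ℕ}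
    (Q : StarGraph 2 A) {c : Sym2 A → Fin q} (hc : ¬ HasMonoCopy Q.graph F c)
    (hne : c s(Q.center, Q.root 0) ≠ c s(Q.center, Q.root 1)) {α β : Fin q} (hαβ : α ≠ β) :
    ∃ c' : Sym2 A → Fin q, ¬ HasMonoCopy Q.graph F c' ∧
      c' s(Q.center, Q.root 0) = α ∧ c' s(Q.center, Q.root 1) = β := by
  let σ := Equiv.swap (c s(Q.center, Q.root 0)) α
  let τ := Equiv.swap (σ (c s(Q.center, Q.root 1))) β
  have h0 : σ (c s(Q.center, Q.root 0)) = α := Equiv.swap_apply_left _ _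
  have h1 : α ≠ σ (c s(Q.center, Q.root 1)) := h0 ▸ σ.injective.ne hne
  refine ⟨(σ.trans τ) ∘ c, fun h => hc (hasMonoCopy_perm _ h), ?_, Equiv.swap_apply_left _ _⟩
  change τ (σ _) = α
  rw [h0]
  exact Equiv.swap_apply_of_ne_of_ne h1 hαβ

section Equivalent

variable {W W' : Type} [Fintype W] [Fintype W'] {F : SimpleGraph W} {F' : SimpleGraph W'} {q : ℕ}

/-- If `F` and `F'` have the same Ramsey graphs, then two edges at a common vertex can be forced
to have equal colours in colourings without monochromatic copy of `F`, while every colouring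
without monochromatic copy of `F'` that satisfies the constraint remains extendable. -/
theorem exists_equalizer (hF : RemovalConnected F) (hF' : RemovalConnected F') (hq : 2 ≤ q)
    (heq : ∀ (U : Type) [Fintype U] (G : SimpleGraph U), IsRamsey q G F ↔ IsRamsey q G F')
    {U : Type} [Fintype U] (G : SimpleGraph U) {v x y : U} (hvx : G.Adj v x) (hvy : G.Adj v y)
    (hxy : x ≠ y) :
    ∃ (U' : Type) (_ : Fintype U') (G' : SimpleGraph U') (f : U ↪ U'),
      (∀ a b, G.Adj a b → G'.Adj (f a) (f b)) ∧
      (∀ c : Sym2 U' → Fin q, ¬ HasMonoCopy G' F c → c s(f v, f x) = c s(f v, f y)) ∧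
      ∀ c : Sym2 U → Fin q, ¬ HasMonoCopy G F' c → c s(v, x) = c s(v, y) →
        ∃ c' : Sym2 U' → Fin q, ¬ HasMonoCopy G' F' c' ∧
          ∀ a b, G.Adj a b → c' s(f a, f b) = c s(a, b) := by
  classical
  have hq0 : 0 < q := by omega
  let s := max (Fintype.card (W × W)) (Fintype.card (W' × W')) + 2
  have hs : 2 ≤ s := by omega
  have hW : Fintype.card (W × W) ≤ s := by omega
  have hW' : Fintype.card (W' × W') ≤ s := by omega
  obtain ⟨B, _, Q, hQc, hQ⟩ := exists_distinct_gadget hF hq hs hW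
  obtain ⟨V, I, _, _, ρ, hρ, hleaf, hU⟩ := exists_system_hasLeaves (k := 2) s hq0 (by omega)
  obtain ⟨c₁, hc₁, hne₁⟩ : ∃ c : Sym2 B → Fin q, ¬ HasMonoCopy Q.graph F' c ∧
      c s(Q.center, Q.root 0) ≠ c s(Q.center, Q.root 1) := by
    by_contra! hcon
    obtain ⟨c₀, hc₀⟩ : ∃ c : Sym2 B → Fin q, ¬ HasMonoCopy Q.graph F' c := by
      have := (heq B Q.graph).not
      simp only [IsRamsey, not_forall] at this
      exact this.1 hQc
    obtain ⟨X, _, R, u, t, f, hadj, hcen, hroot, hext⟩ :=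
      StarGraph.exists_amalgam (fun _ : I => Q) ρ hq0 hs hρ hleaf
    obtain ⟨c, hc, -⟩ := hext F' hF' hW' (fun _ => c₀ s(Q.center, Q.root 0)) (fun _ => c₀)
      (fun _ => hc₀) (fun _ a => by
        fin_cases a
        · rfl
        · exact (hcon c₀ hc₀).symm)
    obtain ⟨c, hc⟩ : ∃ c : Sym2 X → Fin q, ¬ HasMonoCopy R F c := by
      have := (heq X R).not
      simp only [IsRamsey, not_forall] at this
      exact this.2 ⟨c, hc⟩
    obtain ⟨i, γ, hi⟩ := hU fun z => c s(u, t z)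
    refine hQ (c ∘ Sym2.map (f i)) (fun h => hc (h.map (f i) (hadj i) fun _ _ _ => rfl)) ?_
    simp only [Function.comp, Sym2.map_mk]
    rw [hroot, hroot, hcen, hi, hi]
  obtain ⟨I', ⟨χ₀, hχ₀⟩, hmax⟩ := (Set.toFinite
    {J : Finset I | ∃ χ : V → Fin q, ∀ i ∈ J, χ (ρ i 0) ≠ χ (ρ i 1)}).exists_maximal
    ⟨∅, fun _ => ⟨0, hq0⟩, by simp⟩
  obtain ⟨i₀, hi₀⟩ : ∃ i, i ∉ I' := by
    obtain ⟨i, γ, hi⟩ := hU χ₀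
    exact ⟨i, fun h => hχ₀ i h ((hi 0).trans (hi 1).symm)⟩
  have hforce : ∀ χ : V → Fin q, (∀ i ∈ I', χ (ρ i 0) ≠ χ (ρ i 1)) →
      χ (ρ i₀ 0) = χ (ρ i₀ 1) := by
    intro χ hχ
    by_contra h
    exact hi₀ (hmax ⟨χ, by simpa [h] using hχ⟩ (Finset.subset_insert i₀ I')
      (Finset.mem_insert_self _ _))
  let φ : Option I' ↪ I := ⟨fun o => o.elim i₀ Subtype.val, by
    rintro (_ | ⟨i, hi⟩) (_ | ⟨j, hj⟩) h
    · rfl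
    · exact absurd (show i₀ = j from h) fun h => hi₀ (h ▸ hj)
    · exact absurd (show i = i₀ from h) fun h => hi₀ (h ▸ hi)
    · exact congrArg some (Subtype.ext h)⟩
  let A : Option I' → Type := fun o => o.elim U fun _ => B
  let _ : ∀ o, Fintype (A o) := fun
    | none => ‹Fintype U›
    | some _ => ‹Fintype B›
  let P₀ : StarGraph 2 U :=
    { graph := G
      center := v
      root := ⟨![x, y], fun a b h => by
        fin_cases a <;> fin_cases b <;>
          first | rfl | exact absurd h hxy | exact absurd h.symm hxy⟩
      adj := fun a => by
        fin_cases a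
        · exact hvx
        · exact hvy }
  let P : ∀ o, StarGraph 2 (A o) := fun
    | none => P₀
    | some _ => Q
  obtain ⟨X, _, R, u, t, f, hadj, hcen, hroot, hext⟩ :=
    StarGraph.exists_amalgam P (ρ ∘ φ) hq0 hs (fun _ => hρ _) (hleaf.comp φ)
  let g : U ↪ X := f none
  let g' : I' → B ↪ X := fun i => f (some i)
  have hv : g v = u := hcen none
  have hx : g x = t (ρ i₀ 0) := hroot none 0
  have hy : g y = t (ρ i₀ 1) := hroot none 1
  have hcen' : ∀ i, g' i Q.center = u := fun i => hcen (some i)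
  have hroot' : ∀ i a, g' i (Q.root a) = t (ρ i a) := fun i => hroot (some i)
  have hadj' : ∀ i a b, Q.graph.Adj a b → R.Adj (g' i a) (g' i b) := fun i => hadj (some i)
  refine ⟨X, inferInstance, R, g, hadj none, ?_, ?_⟩
  · intro c hc
    rw [hv, hx, hy]
    refine hforce (fun z => c s(u, t z)) fun i hi h => ?_
    refine hQ (c ∘ Sym2.map (g' ⟨i, hi⟩))
      (fun h => hc (h.map (g' ⟨i, hi⟩) (hadj' _) fun _ _ _ => rfl)) ?_
    simp only [Function.comp, Sym2.map_mk]
    rw [hcen', hroot', hroot']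
    exact h
  · intro c hc hcxy
    let σ := Equiv.swap (χ₀ (ρ i₀ 0)) (c s(v, x))
    have hQχ : ∀ i : I', ∃ c : Sym2 B → Fin q, ¬ HasMonoCopy Q.graph F' c ∧
        c s(Q.center, Q.root 0) = σ (χ₀ (ρ i 0)) ∧ c s(Q.center, Q.root 1) = σ (χ₀ (ρ i 1)) :=
      fun i => Q.exists_coloring_of_ne hc₁ hne₁ (σ.injective.ne (hχ₀ i i.2))
    choose d hd hd0 hd1 using hQχ
    let d' : ∀ o, Sym2 (A o) → Fin q := fun
      | none => c
      | some i => d i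
    have h0 : σ (χ₀ (ρ i₀ 0)) = c s(v, x) := Equiv.swap_apply_left _ _
    obtain ⟨c', hc', hcc'⟩ := hext F' hF' hW' (σ ∘ χ₀) d' (fun
      | none => hc
      | some i => hd i) (fun
      | none => fun a => by
        fin_cases a
        · exact h0.symm
        · exact (hcxy.symm.trans h0.symm).trans (congrArg σ (hforce χ₀ hχ₀))
      | some i => fun a => by
        fin_cases a
        · exact hd0 i
        · exact hd1 i)
    exact ⟨c', hc', hcc' none⟩

theorem contained_of_forall_isRamsey_iff (hF : RemovalConnected F) (hF' : RemovalConnected F')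
    (hq : 2 ≤ q)
    (heq : ∀ (U : Type) [Fintype U] (G : SimpleGraph U), IsRamsey q G F ↔ IsRamsey q G F') :
    F'.IsContained F := by
  classical
  by_contra hcon
  have key : ∀ T : Finset (W × W × W),
      (∀ v x y, (v, x, y) ∈ T → F.Adj v x ∧ F.Adj v y ∧ x ≠ y) →
      ∃ (U : Type) (_ : Fintype U) (G : SimpleGraph U) (f : W ↪ U),
        (∀ a b, F.Adj a b → G.Adj (f a) (f b)) ∧
        (∀ c : Sym2 U → Fin q, ¬ HasMonoCopy G F c →
          ∀ v x y, (v, x, y) ∈ T → c s(f v, f x) = c s(f v, f y)) ∧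
        ∃ c : Sym2 U → Fin q, ¬ HasMonoCopy G F' c ∧
          ∃ γ, ∀ a b, F.Adj a b → c s(f a, f b) = γ := by
    intro T
    induction T using Finset.induction_on with
    | empty =>
      refine fun _ => ⟨W, inferInstance, F, Function.Embedding.refl W, fun _ _ => id, by simp,
        fun _ => ⟨0, by omega⟩, ?_, _, fun _ _ _ => rfl⟩
      rintro ⟨_, g, hg⟩
      exact hcon ⟨⟨⟨g, fun h => (hg _ _ h).1⟩, g.injective⟩⟩
    | insert t T _ ih =>
      intro hT
      obtain ⟨v, x, y⟩ := t
      obtain ⟨U, _, G, f, hadj, hT', c, hc, γ, hγ⟩ :=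
        ih fun v x y h => hT v x y (Finset.mem_insert_of_mem h)
      obtain ⟨hvx, hvy, hxy⟩ := hT v x y (Finset.mem_insert_self _ _)
      obtain ⟨U', _, G', f', hadj', hforce, hext⟩ := exists_equalizer hF hF' hq heq G
        (hadj _ _ hvx) (hadj _ _ hvy) (f.injective.ne hxy)
      obtain ⟨c', hc', hcc'⟩ := hext c hc ((hγ _ _ hvx).trans (hγ _ _ hvy).symm)
      refine ⟨U', inferInstance, G', f.trans f', fun a b h => hadj' _ _ (hadj _ _ h), ?_, c', hc',
        γ, fun a b h => (hcc' _ _ (hadj _ _ h)).trans (hγ _ _ h)⟩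
      intro c hc a b b' h
      rcases Finset.mem_insert.1 h with h | h
      · obtain ⟨rfl, rfl, rfl⟩ : a = v ∧ b = x ∧ b' = y := by simpa using h
        exact hforce c hc
      · exact hT' (c ∘ Sym2.map f') (fun h => hc (h.map f' hadj' fun _ _ _ => rfl)) a b b' h
  obtain ⟨U, _, G, f, hadj, hforce, c, hc, -⟩ := key
    (Finset.univ.filter fun t => F.Adj t.1 t.2.1 ∧ F.Adj t.1 t.2.2 ∧ t.2.1 ≠ t.2.2) (by simp)
  refine hc ((heq U G).1 (fun c => ?_) c)
  by_contra hc
  have hstar : ∀ v x y, F.Adj v x → F.Adj v y → c s(f v, f x) = c s(f v, f y) := by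
    intro v x y hx hy
    by_cases hxy : x = y
    · rw [hxy]
    · exact hforce c hc v x y (by simp [hx, hy, hxy])
  obtain ⟨w, -⟩ := hF.exists_not_mem ∅ (by simp)
  obtain ⟨w', hw, -⟩ := hF.exists_adj_ne w w
  rcases hF.all_or_none ∅ (by simp) (fun a => ∀ b, F.Adj a b → c s(f a, f b) = c s(f w, f w'))
    (fun a b _ _ hab ha z hz => by
      rw [← ha b hab, hstar b z a hz hab.symm, Sym2.eq_swap]) with h | h
  · exact hc ⟨_, f, fun a b hab => ⟨hadj a b hab, h a (by simp) b hab⟩⟩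
  · exact h w (by simp) fun b hb => hstar _ _ _ hb hw

end Equivalent

theorem copy_surjective {V V' : Type} [Finite V] [Finite V'] {G : SimpleGraph V}
    {G' : SimpleGraph V'} (f : Copy G G')
    (h : Nat.card V' + Nat.card G'.Dart ≤ Nat.card V + Nat.card G.Dart) :
    Function.Surjective f ∧ ∀ a b, G'.Adj (f a) (f b) → G.Adj a b := by
  have : Finite G.Dart := Finite.of_injective _ Dart.toProd_injective
  have : Finite G'.Dart := Finite.of_injective _ Dart.toProd_injective
  let g : G.Dart → G'.Dart := fun d => ⟨(f d.fst, f d.snd), f.toHom.map_adj d.adj⟩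
  have hg : Function.Injective g := fun d d' h => by
    have h := congrArg Dart.toProd h
    exact Dart.ext _ _ (Prod.ext (f.injective (congrArg Prod.fst h))
      (f.injective (congrArg Prod.snd h)))
  have h1 := Nat.card_le_card_of_injective f f.injective
  have h2 := Nat.card_le_card_of_injective g hg
  refine ⟨(f.injective.bijective_of_nat_card_le (by omega)).2, fun a b hab => ?_⟩
  obtain ⟨d, hd⟩ := (hg.bijective_of_nat_card_le (by omega)).2 ⟨(f a, f b), hab⟩
  have hd := congrArg Dart.toProd hd
  rw [← f.injective (congrArg Prod.fst hd), ← f.injective (congrArg Prod.snd hd)]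
  exact d.adj

theorem nonempty_iso_of_isContained {V V' : Type} [Finite V] [Finite V'] {G : SimpleGraph V}
    {G' : SimpleGraph V'} (h : G.IsContained G') (h' : G'.IsContained G) :
    Nonempty (G ≃g G') := by
  wlog hle : Nat.card V' + Nat.card G'.Dart ≤ Nat.card V + Nat.card G.Dart generalizing V V'
  · exact (this h' h (by omega)).map Iso.symm
  obtain ⟨f⟩ := h
  obtain ⟨hsurj, hadj⟩ := copy_surjective f hle
  exact ⟨⟨Equiv.ofBijective f ⟨f.injective, hsurj⟩, ⟨hadj _ _, f.toHom.map_adj⟩⟩⟩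

theorem IsRamsey.isContained {V V' W : Type} {G : SimpleGraph V} {G' : SimpleGraph V'}
    {F : SimpleGraph W} {q : ℕ} (h : IsRamsey q G F) (hG : G.IsContained G') :
    IsRamsey q G' F := by
  obtain ⟨f⟩ := hG
  exact h.map ⟨f, f.injective⟩ fun _ _ hab => f.toHom.map_adj hab

theorem IsRamsey.exists_isRamseyMinimal {U W : Type} [Fintype U] {G : SimpleGraph U}
    {F : SimpleGraph W} {q : ℕ} (hG : IsRamsey q G F) :
    ∃ (n : ℕ) (G' : SimpleGraph (Fin n)), IsRamseyMinimal q G' F ∧ G'.IsContained G := by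
  classical
  have relabel : ∀ {V : Type} [Fintype V] (K : SimpleGraph V),
      Nonempty (K.comap (Fintype.equivFin V).symm ≃g K) := fun K => ⟨Iso.comap _ K⟩
  have hex : ∃ m n, ∃ K : SimpleGraph (Fin n), IsRamsey q K F ∧ K.IsContained G ∧
      Nat.card (Fin n) + Nat.card K.Dart = m := by
    obtain ⟨e⟩ := relabel G
    exact ⟨_, _, _, hG.isContained e.isContained', e.isContained, rfl⟩
  obtain ⟨n, K, hK, hKG, hcard⟩ := Nat.find_spec hex
  refine ⟨n, K, ⟨hK, fun S hS hSR => hS ?_⟩, hKG⟩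
  obtain ⟨e⟩ := relabel S.coe
  have hle := Nat.find_min' hex ⟨_, _, hSR.isContained e.isContained',
    e.isContained.trans (S.coe_isContained.trans hKG), rfl⟩
  rw [← hcard] at hle
  obtain ⟨hsurj, hadj⟩ := copy_surjective (S.coeCopy.comp e.toCopy) hle
  have hverts : ∀ v, ∃ a, (e a : Fin n) = v := hsurj
  refine Subgraph.ext (Set.eq_univ_of_forall fun v => ?_) ?_
  · obtain ⟨a, rfl⟩ := hverts v
    exact (e a).2
  · ext v w
    refine ⟨fun h => h.adj_sub, fun h => ?_⟩
    obtain ⟨a, rfl⟩ := hverts v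
    obtain ⟨b, rfl⟩ := hverts w
    exact e.map_adj_iff.2 (hadj a b h)

theorem IsRamsey.of_isRamseyMinimal {W W' : Type} {F : SimpleGraph W} {F' : SimpleGraph W'}
    {q : ℕ} (h : ∀ (n : ℕ) (G : SimpleGraph (Fin n)),
      IsRamseyMinimal q G F → IsRamseyMinimal q G F')
    {U : Type} [Fintype U] {G : SimpleGraph U} (hG : IsRamsey q G F) : IsRamsey q G F' := by
  obtain ⟨n, K, hK, hKG⟩ := hG.exists_isRamseyMinimal
  exact (h n K hK).1.isContained hKG

/-- If `H` and `H'` are non-isomorphic graphs, each 3-connected or a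
triangle, then for every `q ≥ 2` there is a graph that is `q`-Ramsey-minimal for
exactly one of them. -/
theorem stmt3 {VH VH' : Type} [Fintype VH] [Fintype VH']
    (H : SimpleGraph VH) (H' : SimpleGraph VH')
    (hH : ThreeConnOrK3 H) (hH' : ThreeConnOrK3 H')
    (hne : IsEmpty (H ≃g H'))
    (q : ℕ) (hq : 2 ≤ q) :
    ∃ (n : ℕ) (G : SimpleGraph (Fin n)),
      ¬ (IsRamseyMinimal q G H ↔ IsRamseyMinimal q G H') := by
  by_contra! hcon
  have heq : ∀ (U : Type) [Fintype U] (G : SimpleGraph U), IsRamsey q G H ↔ IsRamsey q G H' :=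
    fun U _ G => ⟨fun h => h.of_isRamseyMinimal fun n G => (hcon n G).1,
      fun h => h.of_isRamseyMinimal fun n G => (hcon n G).2⟩
  obtain ⟨e⟩ := nonempty_iso_of_isContained
    (contained_of_forall_isRamsey_iff hH'.removalConnected hH.removalConnected hq
      fun U _ G => (heq U G).symm)
    (contained_of_forall_isRamsey_iff hH.removalConnected hH'.removalConnected hq heq)
  exact hne.false e
end

section
/- For all integers k ≥ 3 and q ≥ 3, the graphs K_k and K_k·K_2 are not q-Ramsey-equivalent; that is, there exists a graph G with G → (K_k)_q but G ↛ (K_k·K_2)_q. -/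
open SimpleGraph

/-- `K_k · K₂`: the complete graph on the first `k` vertices of `Fin (k+1)` together with
a pendant edge joining the last vertex to vertex `0`. -/
def cliqueWithPendant (k : ℕ) : SimpleGraph (Fin (k + 1)) :=
  SimpleGraph.fromRel (fun x y =>
    ((x : ℕ) < k ∧ (y : ℕ) < k) ∨ ((x : ℕ) = 0 ∧ (y : ℕ) = k))

/-! ### Ramsey's theorem for pairs -/

/-- A long sequence contains a long subsequence in which the colour of a pair depends only on its
smaller element. -/
theorem exists_min_determined {κ : Type} [Finite κ] (m : ℕ) :
    ∃ N : ℕ, ∀ (C : ℕ → ℕ → κ) (S : Finset ℕ), N ≤ S.card →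
      ∃ (f : Fin m → ℕ) (d : Fin m → κ), StrictMono f ∧ (∀ a, f a ∈ S) ∧
        ∀ a b, a < b → C (f a) (f b) = d a := by
  classical
  have := Fintype.ofFinite κ
  induction m with
  | zero =>
    exact ⟨0, fun C S _ => ⟨Fin.elim0, Fin.elim0, fun a => a.elim0, fun a => a.elim0,
      fun a => a.elim0⟩⟩
  | succ m ih =>
    obtain ⟨N, hN⟩ := ih
    refine ⟨Fintype.card κ * N + 2, fun C S hS => ?_⟩
    have hne : S.Nonempty := Finset.card_pos.mp (by omega)
    set x := S.min' hne with hx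
    have hcard : (S.erase x).card = S.card - 1 := Finset.card_erase_of_mem (S.min'_mem hne)
    obtain ⟨c, -, hc⟩ := Finset.exists_lt_card_fiber_of_mul_lt_card_of_maps_to
      (s := S.erase x) (t := Finset.univ) (f := C x) (n := N) (fun _ _ => Finset.mem_univ _)
      (by rw [hcard, Finset.card_univ]; omega)
    obtain ⟨f, d, hf, hfS, hd⟩ := hN C _ hc.le
    simp only [Finset.mem_filter, Finset.mem_erase] at hfS
    refine ⟨Fin.cons x f, Fin.cons c d, ?_, ?_, ?_⟩
    · exact Fin.strictMono_cons.mpr ⟨fun a =>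
        lt_of_le_of_ne (S.min'_le _ (hfS a).1.2) (hfS a).1.1.symm, hf⟩
    · intro a
      refine Fin.cases ?_ (fun a => ?_) a
      · exact S.min'_mem hne
      · simpa using (hfS a).1.2
    · intro a b
      refine Fin.cases ?_ (fun b => ?_) b
      · intro h; exact absurd h (Fin.not_lt_zero a)
      refine Fin.cases ?_ (fun a => ?_) a
      · intro _; simpa using (hfS b).2
      · intro h; simpa using hd a b (by simpa using h)

/-- Ramsey's theorem for pairs. -/
theorem exists_homogeneous {κ : Type} [Finite κ] [Nonempty κ] (k : ℕ) :
    ∃ r : ℕ, ∀ C : Fin r → Fin r → κ,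
      ∃ (f : Fin k → Fin r) (c : κ), StrictMono f ∧ ∀ a b, a < b → C (f a) (f b) = c := by
  classical
  have := Fintype.ofFinite κ
  obtain ⟨N, hN⟩ := exists_min_determined (κ := κ) (Fintype.card κ * k + 1)
  refine ⟨N, fun C => ?_⟩
  obtain ⟨f, d, hf, hfS, hd⟩ := hN
    (fun a b => if h : a < N ∧ b < N then C ⟨a, h.1⟩ ⟨b, h.2⟩ else Classical.arbitrary κ)
    (Finset.range N) (by simp)
  simp only [Finset.mem_range] at hfS
  obtain ⟨c, -, hc⟩ := Finset.exists_lt_card_fiber_of_mul_lt_card_of_maps_to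
    (s := (Finset.univ : Finset (Fin (Fintype.card κ * k + 1)))) (t := Finset.univ) (f := d)
    (n := k) (fun _ _ => Finset.mem_univ _) (by simp)
  obtain ⟨T, hT, hTk⟩ := Finset.exists_subset_card_eq hc.le
  refine ⟨fun a => ⟨f (T.orderEmbOfFin hTk a), hfS _⟩, c, ?_, ?_⟩
  · intro a b h
    exact hf ((T.orderEmbOfFin hTk).strictMono h)
  · intro a b h
    have h1 := hd _ _ ((T.orderEmbOfFin hTk).strictMono h)
    rw [dif_pos ⟨hfS _, hfS _⟩] at h1
    rw [h1]
    have := hT (T.orderEmbOfFin_mem hTk a)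
    simpa using this

/-! ### Partite systems and the partite construction -/

/-- A graph with edges labelled by `C` whose vertices are distributed over parts indexed by `J`,
without edges inside a part. -/
structure PartiteSystem (J C V : Type) where
  /-- `lab v w i`: the pair `v, w` is an edge with label `i`. -/
  lab : V → V → C → Prop
  /-- The part containing a given vertex. -/
  proj : V → J
  symm : ∀ {v w i}, lab v w i → lab w v i
  uniq : ∀ {v w i j}, lab v w i → lab v w j → i = j
  proj_ne : ∀ {v w i}, lab v w i → proj v ≠ proj w

namespace PartiteSystem

variable {J C V V' V'' : Type}

/-- Every labelled clique of `Q` on at least two vertices has a counterpart in `P`. -/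
def LocallyMapsTo (Q : PartiteSystem J C V') (P : PartiteSystem J C V) : Prop :=
  ∀ (m : ℕ) (_ : 2 ≤ m) (g : Fin m → V') (t : Fin m → Fin m → C),
    (∀ a b, a ≠ b → Q.lab (g a) (g b) (t a b)) →
    ∃ g' : Fin m → V, (∀ a, P.proj (g' a) = Q.proj (g a)) ∧
      ∀ a b, a ≠ b → P.lab (g' a) (g' b) (t a b)

theorem LocallyMapsTo.refl (P : PartiteSystem J C V) : P.LocallyMapsTo P :=
  fun _ _ g _ h => ⟨g, fun _ => rfl, h⟩

theorem LocallyMapsTo.trans {R : PartiteSystem J C V''} {Q : PartiteSystem J C V'}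
    {P : PartiteSystem J C V} (h₁ : R.LocallyMapsTo Q) (h₂ : Q.LocallyMapsTo P) :
    R.LocallyMapsTo P := by
  intro m hm g t h
  obtain ⟨g₁, hp₁, hl₁⟩ := h₁ m hm g t h
  obtain ⟨g₂, hp₂, hl₂⟩ := h₂ m hm g₁ t hl₁
  exact ⟨g₂, fun a => (hp₂ a).trans (hp₁ a), hl₂⟩

/-- A map preserving parts and labelled edges. -/
structure IsHom (P : PartiteSystem J C V) (Q : PartiteSystem J C V') (φ : V → V') : Prop where
  proj_eq : ∀ v, Q.proj (φ v) = P.proj v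
  lab : ∀ {v w i}, P.lab v w i → Q.lab (φ v) (φ w) i

theorem IsHom.comp {P : PartiteSystem J C V} {Q : PartiteSystem J C V'}
    {R : PartiteSystem J C V''} {ψ : V' → V''} {φ : V → V'} (hψ : Q.IsHom R ψ)
    (hφ : P.IsHom Q φ) : P.IsHom R (ψ ∘ φ) :=
  ⟨fun v => (hψ.proj_eq _).trans (hφ.proj_eq v), fun h => hψ.lab (hφ.lab h)⟩

section Amalgam

variable (P : PartiteSystem J C V) (x y : J) (i : C)

/-- The edges with label `i` between the parts `x` and `y`. -/
def EdgesBetween : Type :=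
  {p : V × V // P.proj p.1 = x ∧ P.proj p.2 = y ∧ P.lab p.1 p.2 i}

variable {P x y i} {ι : Type}

open Classical in
/-- The copy of `P` attached along a combinatorial line `l`: vertices in the parts `x` and `y` are
sent to words, the other vertices are private to `l`. -/
noncomputable def lineCopy (l : Combinatorics.Line (P.EdgesBetween x y i) ι) (v : V) :
    (ι → V) ⊕ (Combinatorics.Line (P.EdgesBetween x y i) ι × V) :=
  if P.proj v = x ∨ P.proj v = y then
    Sum.inl fun n => (l.idxFun n).elim v fun p => if P.proj v = x then p.1.1 else p.1.2
  else Sum.inr (l, v)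

variable {l l' : Combinatorics.Line (P.EdgesBetween x y i) ι} {v v' w w' : V} {j : C}

theorem lineCopy_of_left (h : P.proj v = x) :
    lineCopy l v = Sum.inl fun n => (l.idxFun n).elim v fun p => p.1.1 := by
  simp [lineCopy, h]

theorem lineCopy_of_right (hxy : x ≠ y) (h : P.proj v = y) :
    lineCopy l v = Sum.inl fun n => (l.idxFun n).elim v fun p => p.1.2 := by
  simp [lineCopy, h, hxy.symm]

theorem lineCopy_of_not (h : ¬ (P.proj v = x ∨ P.proj v = y)) :
    lineCopy l v = Sum.inr (l, v) := by
  rw [lineCopy, if_neg h]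

/-- The part of a vertex of the amalgam; `n` is an arbitrary coordinate. -/
def amalgamProj (P : PartiteSystem J C V) (x y : J) (i : C) (n : ι) :
    (ι → V) ⊕ (Combinatorics.Line (P.EdgesBetween x y i) ι × V) → J :=
  Sum.elim (fun s => P.proj (s n)) fun p => P.proj p.2

theorem amalgamProj_lineCopy (hxy : x ≠ y) (n : ι) (l : Combinatorics.Line (P.EdgesBetween x y i) ι)
    (v : V) : amalgamProj P x y i n (lineCopy l v) = P.proj v := by
  by_cases h : P.proj v = x
  · rw [lineCopy_of_left h]
    cases hl : l.idxFun n with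
    | none => simp [amalgamProj, hl]
    | some p => simp [amalgamProj, hl, h, p.2.1]
  by_cases h' : P.proj v = y
  · rw [lineCopy_of_right hxy h']
    cases hl : l.idxFun n with
    | none => simp [amalgamProj, hl]
    | some p => simp [amalgamProj, hl, h', p.2.2.1]
  · rw [lineCopy_of_not (by tauto)]
    rfl

theorem proj_eq_of_lineCopy_eq (hxy : x ≠ y) (h : lineCopy l v = lineCopy l' v') :
    P.proj v = P.proj v' := by
  obtain ⟨n, -⟩ := l.proper
  rw [← amalgamProj_lineCopy hxy n l v, h, amalgamProj_lineCopy]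
  exact hxy

theorem lineCopy_injective (hxy : x ≠ y) : Function.Injective (lineCopy l) := by
  intro v w h
  have hp := proj_eq_of_lineCopy_eq hxy h
  obtain ⟨n, hn⟩ := l.proper
  by_cases hx : P.proj v = x
  · rw [lineCopy_of_left hx, lineCopy_of_left (hp ▸ hx)] at h
    simpa [hn] using congrFun (Sum.inl.inj h) n
  by_cases hy : P.proj v = y
  · rw [lineCopy_of_right hxy hy, lineCopy_of_right hxy (hp ▸ hy)] at h
    simpa [hn] using congrFun (Sum.inl.inj h) n
  · rw [lineCopy_of_not (by tauto), lineCopy_of_not (by rw [← hp]; tauto)] at h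
    exact congrArg Prod.snd (Sum.inr.inj h)

theorem line_eq_of_lineCopy_eq (hxy : x ≠ y) (hv : ¬ (P.proj v = x ∨ P.proj v = y))
    (h : lineCopy l v = lineCopy l' v') : l = l' ∧ v = v' := by
  have hp := proj_eq_of_lineCopy_eq hxy h
  rw [lineCopy_of_not hv, lineCopy_of_not (by rwa [← hp])] at h
  simpa using h

/-- The copies of `P` are induced: an edge of one copy between two vertices of another copy already
belongs to the latter. Here, for edges between the parts `x` and `y`. -/
theorem lab_of_lineCopy_eq_of_proj (hxy : x ≠ y) (hx : P.proj w = x) (hy : P.proj w' = y)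
    (h : lineCopy l v = lineCopy l' w) (h' : lineCopy l v' = lineCopy l' w')
    (hj : P.lab v v' j) : P.lab w w' j := by
  have hvx := (proj_eq_of_lineCopy_eq hxy h).trans hx
  have hvy := (proj_eq_of_lineCopy_eq hxy h').trans hy
  rw [lineCopy_of_left hx, lineCopy_of_left hvx] at h
  rw [lineCopy_of_right hxy hy, lineCopy_of_right hxy hvy] at h'
  replace h := congrFun (Sum.inl.inj h)
  replace h' := congrFun (Sum.inl.inj h')
  obtain ⟨n, hn⟩ := l.proper
  obtain ⟨n', hn'⟩ := l'.proper
  have e := h n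
  have e' := h' n
  have d := h n'
  have d' := h' n'
  cases hl : l'.idxFun n with
  | none =>
    simp only [hn, hl, Option.elim_none] at e e'
    rwa [← e, ← e']
  | some p =>
    simp only [hn, hl, Option.elim_none, Option.elim_some] at e e'
    have hji : j = i := P.uniq hj (by rw [e, e']; exact p.2.2.2)
    cases hl' : l.idxFun n' with
    | none =>
      simp only [hn', hl', Option.elim_none] at d d'
      rwa [← d, ← d']
    | some p' =>
      simp only [hn', hl', Option.elim_none, Option.elim_some] at d d'
      rw [← d, ← d', hji]
      exact p'.2.2.2

theorem lab_of_lineCopy_eq (hxy : x ≠ y)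
    (h : lineCopy l v = lineCopy l' w) (h' : lineCopy l v' = lineCopy l' w')
    (hj : P.lab v v' j) : P.lab w w' j := by
  have hp := proj_eq_of_lineCopy_eq hxy h
  have hp' := proj_eq_of_lineCopy_eq hxy h'
  by_cases hv : P.proj v = x ∨ P.proj v = y
  · by_cases hv' : P.proj v' = x ∨ P.proj v' = y
    · have hne := P.proj_ne hj
      rcases hv with hv | hv <;> rcases hv' with hv' | hv'
      · exact absurd (hv.trans hv'.symm) hne
      · exact lab_of_lineCopy_eq_of_proj hxy (hp ▸ hv) (hp' ▸ hv') h h' hj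
      · exact P.symm (lab_of_lineCopy_eq_of_proj hxy (hp' ▸ hv') (hp ▸ hv) h' h (P.symm hj))
      · exact absurd (hv.trans hv'.symm) hne
    · obtain ⟨rfl, rfl⟩ := line_eq_of_lineCopy_eq hxy hv' h'
      rwa [← lineCopy_injective hxy h]
  · obtain ⟨rfl, rfl⟩ := line_eq_of_lineCopy_eq hxy hv h
    rwa [← lineCopy_injective hxy h']

variable (P) in
/-- The union of the copies of `P` attached along all combinatorial lines. -/
noncomputable def amalgam (hxy : x ≠ y) (i : C) (n : ι) :
    PartiteSystem J C ((ι → V) ⊕ (Combinatorics.Line (P.EdgesBetween x y i) ι × V)) where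
  lab a b j := ∃ l v w, lineCopy l v = a ∧ lineCopy l w = b ∧ P.lab v w j
  proj := amalgamProj P x y i n
  symm := by
    rintro _ _ _ ⟨l, v, w, rfl, rfl, h⟩
    exact ⟨l, w, v, rfl, rfl, P.symm h⟩
  uniq := by
    rintro _ _ _ _ ⟨l, v, w, rfl, rfl, h⟩ ⟨l', v', w', e, e', h'⟩
    exact P.uniq h (lab_of_lineCopy_eq hxy e e' h')
  proj_ne := by
    rintro _ _ _ ⟨l, v, w, rfl, rfl, h⟩
    rw [amalgamProj_lineCopy hxy, amalgamProj_lineCopy hxy]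
    exact P.proj_ne h

theorem isHom_lineCopy (hxy : x ≠ y) (n : ι) : P.IsHom (P.amalgam hxy i n) (lineCopy l) :=
  ⟨fun v => amalgamProj_lineCopy hxy n l v, fun h => ⟨l, _, _, rfl, rfl, h⟩⟩

theorem amalgam_locallyMapsTo (hxy : x ≠ y) (n : ι) :
    (P.amalgam hxy i n).LocallyMapsTo P := by
  intro m hm g t h
  suffices ∃ (l : Combinatorics.Line (P.EdgesBetween x y i) ι) (g' : Fin m → V),
      ∀ a, lineCopy l (g' a) = g a by
    obtain ⟨l, g', hg⟩ := this
    refine ⟨g', fun a => ?_, fun a b hab => ?_⟩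
    · rw [← hg a]
      exact ((isHom_lineCopy hxy n).proj_eq (g' a)).symm
    · obtain ⟨l', v, w, e, e', hl⟩ := h a b hab
      exact lab_of_lineCopy_eq hxy (e.trans (hg a).symm) (e'.trans (hg b).symm) hl
  by_cases hr : ∃ a p, g a = Sum.inr p
  · obtain ⟨a, ⟨l, v⟩, ha⟩ := hr
    refine ⟨l, ?_⟩
    suffices ∀ b, ∃ w, lineCopy l w = g b by
      choose g' hg' using this
      exact ⟨g', hg'⟩
    have key : ∀ b, b ≠ a → ∃ w u, lineCopy l w = g b ∧ lineCopy l u = g a := by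
      intro b hb
      obtain ⟨l', u, w, e, e', -⟩ := h a b hb.symm
      have hu : ¬ (P.proj u = x ∨ P.proj u = y) := by
        intro hu
        rw [lineCopy, if_pos hu, ha] at e
        cases e
      rw [ha, lineCopy_of_not hu] at e
      obtain ⟨rfl, rfl⟩ : l' = l ∧ u = v := by simpa using e
      exact ⟨w, u, e', by rw [lineCopy_of_not hu, ha]⟩
    intro b
    by_cases hb : b = a
    · subst hb
      have : Nontrivial (Fin m) := Fin.nontrivial_iff_two_le.mpr hm
      obtain ⟨b', hb'⟩ := exists_ne b
      obtain ⟨-, u, -, hu⟩ := key b' hb'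
      exact ⟨u, hu⟩
    · obtain ⟨w, -, hw, -⟩ := key b hb
      exact ⟨w, hw⟩
  · have hproj : ∀ a, (P.amalgam hxy i n).proj (g a) = x ∨ (P.amalgam hxy i n).proj (g a) = y := by
      intro a
      have : Nontrivial (Fin m) := Fin.nontrivial_iff_two_le.mpr hm
      obtain ⟨b, hb⟩ := exists_ne a
      obtain ⟨l, v, w, e, -, -⟩ := h a b hb.symm
      rw [← e, (isHom_lineCopy hxy n).proj_eq]
      by_contra hv
      rw [lineCopy_of_not hv] at e
      exact hr ⟨a, _, e.symm⟩
    obtain ⟨l, v, w, e, e', -⟩ := h ⟨0, by omega⟩ ⟨1, by omega⟩ (by simp)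
    refine ⟨l, fun a => if a = ⟨0, by omega⟩ then v else w, fun a => ?_⟩
    by_cases h0 : a = ⟨0, by omega⟩
    · simp only [h0, if_true, e]
    by_cases h1 : a = ⟨1, by omega⟩
    · simp only [h1, Fin.mk.injEq, one_ne_zero, if_false, e']
    have h01 := (P.amalgam hxy i n).proj_ne (h ⟨0, by omega⟩ ⟨1, by omega⟩ (by simp))
    have h0a := (P.amalgam hxy i n).proj_ne (h _ _ h0)
    have h1a := (P.amalgam hxy i n).proj_ne (h _ _ h1)
    have := hproj a
    have := hproj ⟨0, by omega⟩
    have := hproj ⟨1, by omega⟩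
    grind

end Amalgam

theorem exists_uniform_step {κ : Type} [Finite κ] [Nonempty κ] [Finite V]
    (P : PartiteSystem J C V) {x y : J} (hxy : x ≠ y) (i : C) :
    ∃ (V' : Type) (_ : Finite V') (Q : PartiteSystem J C V'), Q.LocallyMapsTo P ∧
      ∀ χ : V' → V' → κ, ∃ φ : V → V', P.IsHom Q φ ∧
        ∃ c, ∀ v w, P.proj v = x → P.proj w = y → P.lab v w i → χ (φ v) (φ w) = c := by
  have : Finite (P.EdgesBetween x y i) := Subtype.finite
  obtain ⟨ι, _, hι⟩ := Combinatorics.Line.exists_mono_in_high_dimension (P.EdgesBetween x y i) κ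
  obtain ⟨l₀, -⟩ := hι fun _ => Classical.arbitrary κ
  obtain ⟨n, -⟩ := l₀.proper
  have : Finite (Combinatorics.Line (P.EdgesBetween x y i) ι) :=
    Finite.of_injective Combinatorics.Line.idxFun fun l l' h => by
      cases l; cases l'; simpa using h
  refine ⟨_, inferInstance, P.amalgam hxy i n, amalgam_locallyMapsTo hxy n, fun χ => ?_⟩
  obtain ⟨l, c, hc⟩ := hι fun s =>
    χ (Sum.inl fun n => (s n).1.1) (Sum.inl fun n => (s n).1.2)
  refine ⟨lineCopy l, isHom_lineCopy hxy n, c, fun v w hv hw h => ?_⟩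
  rw [← hc ⟨(v, w), hv, hw, h⟩, lineCopy_of_left hv, lineCopy_of_right hxy hw]
  have hl (n) : l ⟨(v, w), hv, hw, h⟩ n = (l.idxFun n).getD ⟨(v, w), hv, hw, h⟩ := rfl
  congr 2 <;>
  · funext n
    rw [hl]
    cases l.idxFun n <;> rfl

/-- The partite construction: for a list of requests, each consisting of two parts and a label, there
is a system in which every colouring has a copy of `P` such that the edges belonging to a request
all have the same colour. -/
theorem exists_uniform {κ : Type} [Finite κ] [Nonempty κ] (L : List (J × J × C)) :
    ∀ {V : Type} [Finite V] (P : PartiteSystem J C V),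
    ∃ (V' : Type) (_ : Finite V') (Q : PartiteSystem J C V'), Q.LocallyMapsTo P ∧
      ∀ χ : V' → V' → κ, ∃ φ : V → V', P.IsHom Q φ ∧ ∀ p ∈ L,
        ∃ c, ∀ v w, P.proj v = p.1 → P.proj w = p.2.1 → P.lab v w p.2.2 →
          χ (φ v) (φ w) = c := by
  induction L with
  | nil => exact fun {V} _ P => ⟨V, inferInstance, P, .refl P, fun χ =>
      ⟨id, ⟨fun _ => rfl, id⟩, by simp⟩⟩
  | cons p L ih =>
    intro V _ P
    by_cases hp : p.1 = p.2.1
    · obtain ⟨V', hV', Q, hQ, h⟩ := ih P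
      refine ⟨V', hV', Q, hQ, fun χ => ?_⟩
      obtain ⟨φ, hφ, hL⟩ := h χ
      refine ⟨φ, hφ, List.forall_mem_cons.mpr ⟨⟨Classical.arbitrary κ, fun v w hv hw hl => ?_⟩, hL⟩⟩
      exact absurd (hv.trans (hp.trans hw.symm)) (P.proj_ne hl)
    · obtain ⟨V₁, _, P₁, hP₁, h₁⟩ := exists_uniform_step (κ := κ) P hp p.2.2
      obtain ⟨V', hV', Q, hQ, h⟩ := ih P₁
      refine ⟨V', hV', Q, hQ.trans hP₁, fun χ => ?_⟩
      obtain ⟨φ, hφ, hL⟩ := h χ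
      obtain ⟨φ₁, hφ₁, c, hc⟩ := h₁ fun a b => χ (φ a) (φ b)
      refine ⟨φ ∘ φ₁, hφ.comp hφ₁, List.forall_mem_cons.mpr ⟨⟨c, hc⟩, fun p' hp' => ?_⟩⟩
      obtain ⟨c', hc'⟩ := hL p' hp'
      exact ⟨c', fun v w hv hw hl => hc' _ _ ((hφ₁.proj_eq v).trans hv)
        ((hφ₁.proj_eq w).trans hw) (hφ₁.lab hl)⟩

end PartiteSystem

/-! ### Admissible patterns -/

/-- A typed and labelled ordered `k`-clique which contains neither a `k`-clique with constant label
nor a `(k - 1)`-clique all of whose types and labels are equal to some `s ≠ 0`. Only the values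
`label a b` with `a < b` matter. -/
structure Pattern (k q : ℕ) [NeZero q] where
  type : Fin k → Fin q
  label : Fin k → Fin k → Fin q
  not_const : ∃ a b a' b', a < b ∧ a' < b' ∧ label a b ≠ label a' b'
  not_const_of_type : ∀ s ≠ 0, ∀ d, (∀ a ≠ d, type a = s) →
    ∃ a b, a ≠ d ∧ b ≠ d ∧ a < b ∧ label a b ≠ s

instance (k q : ℕ) [NeZero q] : Finite (Pattern k q) :=
  Finite.of_injective (fun T => (T.type, T.label)) fun T T' h => by
    cases T; cases T'; simpa using h

/-- The disjoint union of all placements of all patterns along `Fin r`. -/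
def patternSystem (k q r : ℕ) [NeZero q] :
    PartiteSystem (Fin r × Fin q) (Fin q) (((Fin k ↪o Fin r) × Pattern k q) × Fin k) where
  lab v w i := v.1 = w.1 ∧ v.2 ≠ w.2 ∧ v.1.2.label (min v.2 w.2) (max v.2 w.2) = i
  proj v := (v.1.1 v.2, v.1.2.type v.2)
  symm := by
    rintro v w i ⟨h, hne, hi⟩
    exact ⟨h.symm, hne.symm, by rw [← h, min_comm, max_comm, hi]⟩
  uniq h h' := h.2.2.symm.trans h'.2.2
  proj_ne := by
    rintro ⟨x, a⟩ ⟨_, b⟩ i ⟨rfl, hne, -⟩ h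
    exact hne (x.1.injective (congrArg Prod.fst h))

/-- The labelled graph contains neither a `k`-clique with constant label nor a `(k - 1)`-clique all
of whose types and labels are equal to some `s ≠ 0`. -/
structure PartiteSystem.IsClean {r q : ℕ} [NeZero q] {V : Type}
    (P : PartiteSystem (Fin r × Fin q) (Fin q) V) (k : ℕ) : Prop where
  not_const : ∀ (i : Fin q) (g : Fin k → V), ¬ ∀ a b, a ≠ b → P.lab (g a) (g b) i
  not_const_of_type : ∀ s ≠ 0, ∀ g : Fin (k - 1) → V, (∀ a, (P.proj (g a)).2 = s) →
    ¬ ∀ a b, a ≠ b → P.lab (g a) (g b) s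

theorem PartiteSystem.IsClean.of_locallyMapsTo {r q k : ℕ} [NeZero q] {V V' : Type} (hk : 3 ≤ k)
    {P : PartiteSystem (Fin r × Fin q) (Fin q) V} {Q : PartiteSystem (Fin r × Fin q) (Fin q) V'}
    (hP : P.IsClean k) (h : Q.LocallyMapsTo P) : Q.IsClean k where
  not_const i g hg := by
    obtain ⟨g', -, hg'⟩ := h k (by omega) g (fun _ _ => i) hg
    exact hP.not_const i g' hg'
  not_const_of_type s hs g ht hg := by
    obtain ⟨g', ht', hg'⟩ := h (k - 1) (by omega) g (fun _ _ => s) hg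
    exact hP.not_const_of_type s hs g' (fun a => by rw [ht', ht]) hg'

theorem exists_range_compl_of_injective {k : ℕ} (hk : 1 ≤ k) {g : Fin (k - 1) → Fin k}
    (hg : Function.Injective g) : ∃ d, ∀ a ≠ d, ∃ b, g b = a := by
  classical
  have hcard : (Finset.univ.image g)ᶜ.card = 1 := by
    rw [Finset.card_compl, Finset.card_image_of_injective _ hg, Finset.card_univ,
      Fintype.card_fin, Fintype.card_fin]
    omega
  obtain ⟨d, hd⟩ := Finset.card_eq_one.mp hcard
  refine ⟨d, fun a ha => ?_⟩
  by_contra hb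
  have : a ∈ (Finset.univ.image g)ᶜ := by simpa using hb
  rw [hd, Finset.mem_singleton] at this
  exact ha this

theorem patternSystem_isClean (k q r : ℕ) [NeZero q] (hk : 3 ≤ k) :
    (patternSystem k q r).IsClean k where
  not_const i g hg := by
    have hinj : Function.Injective fun a => (g a).2 := fun a b hab => by
      by_contra hne
      exact (hg a b hne).2.1 hab
    have hsurj := Finite.injective_iff_surjective.mp hinj
    have hpiece : ∀ a b, (g a).1 = (g b).1 := fun a b => by
      by_cases hab : a = b
      · rw [hab]
      · exact (hg a b hab).1
    have hlabel : ∀ a b, a < b → (g ⟨0, by omega⟩).1.2.label a b = i := by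
      intro a b hab
      obtain ⟨a', rfl⟩ := hsurj a
      obtain ⟨b', rfl⟩ := hsurj b
      have := (hg a' b' (by rintro rfl; exact lt_irrefl _ hab)).2.2
      dsimp only at hab
      rwa [hpiece a' ⟨0, by omega⟩, min_eq_left hab.le, max_eq_right hab.le] at this
    obtain ⟨a, b, a', b', hab, hab', hne⟩ := (g ⟨0, by omega⟩).1.2.not_const
    exact hne ((hlabel a b hab).trans (hlabel a' b' hab').symm)
  not_const_of_type s hs g ht hg := by
    have hinj : Function.Injective fun a => (g a).2 := fun a b hab => by
      by_contra hne
      exact (hg a b hne).2.1 hab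
    obtain ⟨d, hd⟩ := exists_range_compl_of_injective (by omega) hinj
    have hpiece : ∀ a b, (g a).1 = (g b).1 := fun a b => by
      by_cases hab : a = b
      · rw [hab]
      · exact (hg a b hab).1
    obtain ⟨a, b, ha, hb, hab, hne⟩ :=
      (g ⟨0, by omega⟩).1.2.not_const_of_type s hs d fun a ha => by
        obtain ⟨a', rfl⟩ := hd a ha
        rw [hpiece _ a']
        exact ht a'
    obtain ⟨a', rfl⟩ := hd a ha
    obtain ⟨b', rfl⟩ := hd b hb
    have := (hg a' b' (by rintro rfl; exact lt_irrefl _ hab)).2.2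
    rw [hpiece a' ⟨0, by omega⟩, min_eq_left hab.le, max_eq_right hab.le] at this
    exact hne this

/-! ### Attaching a clique -/

section Extension

variable {k q r : ℕ} [NeZero q] {V : Type}

/-- The graph of `P` together with a disjoint `k`-clique, all of whose vertices are joined to all
vertices of nonzero type. -/
def extension (P : PartiteSystem (Fin r × Fin q) (Fin q) V) (k : ℕ) :
    SimpleGraph (V ⊕ Fin k) where
  Adj
    | .inl v, .inl w => ∃ i, P.lab v w i
    | .inl v, .inr _ => (P.proj v).2 ≠ 0
    | .inr _, .inl v => (P.proj v).2 ≠ 0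
    | .inr x, .inr y => x ≠ y
  symm := ⟨by
    rintro (v | x) (w | y) h
    · exact h.imp fun _ => P.symm
    · exact h
    · exact h
    · exact Ne.symm h⟩
  loopless := ⟨by
    rintro (v | x) h
    · obtain ⟨i, hi⟩ := h
      exact P.proj_ne hi rfl
    · exact h rfl⟩

/-- The colouring by labels, by types, and by `0` on the attached clique. -/
noncomputable def extensionColouring (P : PartiteSystem (Fin r × Fin q) (Fin q) V) (k : ℕ) :
    Sym2 (V ⊕ Fin k) → Fin q :=
  Sym2.lift ⟨fun
    | .inl v, .inl w => Classical.epsilon (P.lab v w)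
    | .inl v, .inr _ => (P.proj v).2
    | .inr _, .inl v => (P.proj v).2
    | .inr _, .inr _ => 0, by
    rintro (v | x) (w | y)
    · exact congrArg Classical.epsilon (funext fun i => propext ⟨P.symm, P.symm⟩)
    all_goals rfl⟩

theorem lab_extensionColouring {P : PartiteSystem (Fin r × Fin q) (Fin q) V} {v w : V}
    (h : (extension P k).Adj (.inl v) (.inl w)) :
    P.lab v w (extensionColouring P k s(.inl v, .inl w)) :=
  Classical.epsilon_spec h

theorem not_isRamsey_extension {P : PartiteSystem (Fin r × Fin q) (Fin q) V} (hk : 3 ≤ k)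
    (hP : P.IsClean k) : ¬ IsRamsey q (extension P k) (cliqueWithPendant k) := by
  intro hR
  obtain ⟨i, f, hf⟩ := hR (extensionColouring P k)
  have hclique : ∀ a b : Fin k, a ≠ b →
      (extension P k).Adj (f a.castSucc) (f b.castSucc) ∧
        extensionColouring P k s(f a.castSucc, f b.castSucc) = i := by
    intro a b hab
    refine hf _ _ ?_
    rw [cliqueWithPendant, SimpleGraph.fromRel_adj]
    exact ⟨fun h => hab (Fin.castSucc_injective k h), .inl (.inl ⟨a.2, b.2⟩)⟩
  have hpendant := hf (Fin.castSucc ⟨0, by omega⟩) (Fin.last k) (by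
    rw [cliqueWithPendant, SimpleGraph.fromRel_adj]
    exact ⟨(Fin.castSucc_lt_last _).ne, .inl (.inr ⟨rfl, rfl⟩)⟩)
  by_cases hl : ∀ a : Fin k, ∃ v, f a.castSucc = .inl v
  · choose g hg using hl
    refine hP.not_const i g fun a b hab => ?_
    have := hclique a b hab
    rw [hg, hg] at this
    exact this.2 ▸ lab_extensionColouring this.1
  push Not at hl
  obtain ⟨a, ha⟩ := hl
  obtain ⟨x, hx⟩ : ∃ x, f a.castSucc = .inr x := by
    cases h : f a.castSucc with
    | inl v => exact absurd h (ha v)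
    | inr x => exact ⟨x, rfl⟩
  have htype : ∀ b v, f (Fin.castSucc b) = .inl v → i ≠ 0 ∧ (P.proj v).2 = i := by
    intro b v hv
    have := hclique b a (by rintro rfl; exact ha v hv)
    rw [hv, hx] at this
    exact ⟨this.2 ▸ this.1, this.2⟩
  by_cases hl : ∀ b, b ≠ a → ∃ v, f (Fin.castSucc b) = .inl v
  · obtain ⟨n, rfl⟩ : ∃ n, k = n + 1 := ⟨k - 1, by omega⟩
    choose g hg using fun b => hl (a.succAbove b) (Fin.succAbove_ne a b)
    refine hP.not_const_of_type i (htype _ _ (hg ⟨0, by omega⟩)).1 g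
      (fun b => (htype _ _ (hg b)).2) fun b b' hb => ?_
    have := hclique (a.succAbove b) (a.succAbove b')
      fun h => hb (Fin.succAbove_right_injective h)
    rw [hg, hg] at this
    exact this.2 ▸ lab_extensionColouring this.1
  push Not at hl
  obtain ⟨b, hba, hb⟩ := hl
  obtain ⟨y, hy⟩ : ∃ y, f b.castSucc = .inr y := by
    cases h : f b.castSucc with
    | inl v => exact absurd h (hb v)
    | inr y => exact ⟨y, rfl⟩
  have hi : i = 0 := by
    have := (hclique b a hba).2
    rw [hx, hy] at this
    exact this.symm
  have hr : ∀ d : Fin k, ∃ z, f d.castSucc = .inr z := by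
    intro d
    cases h : f d.castSucc with
    | inl v => exact absurd hi (htype d v h).1
    | inr z => exact ⟨z, rfl⟩
  choose u hu using hr
  have hinj : Function.Injective u := fun d d' h =>
    Fin.castSucc_injective k (f.injective (by rw [hu, hu, h]))
  rw [hu] at hpendant
  cases h : f (Fin.last k) with
  | inl v =>
    rw [h] at hpendant
    exact hpendant.1 (hpendant.2.trans hi)
  | inr z =>
    obtain ⟨d, rfl⟩ := Finite.injective_iff_surjective.mp hinj z
    rw [← hu d] at h
    exact (Fin.castSucc_lt_last d).ne (f.injective h).symm

end Extension

/-! ### Forcing the attached clique -/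

section Forcing

variable {k q : ℕ} [NeZero q]

/-- A colouring of a graph on `V ⊕ Fin k` without monochromatic `k`-cliques for which every pattern
has a copy where the colour of a pair, and the colours between the smaller vertex of the pair and
`Fin k`, depend only on the types and the label of that pair. -/
structure Response (k q : ℕ) [NeZero q] {V : Type} (G : SimpleGraph (V ⊕ Fin k))
    (c : Sym2 (V ⊕ Fin k) → Fin q) where
  copy : Pattern k q → Fin k → V
  pair : Fin q → Fin q → Fin q → Fin q
  star : Fin q → Fin q → Fin q → Fin k → Fin q
  adj : ∀ T a b, a < b → G.Adj (.inl (copy T a)) (.inl (copy T b))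
  adj_inr : ∀ T a x, T.type a ≠ 0 → G.Adj (.inl (copy T a)) (.inr x)
  adj_inr_inr : ∀ x y, x ≠ y → G.Adj (.inr x) (.inr y)
  pair_eq : ∀ T a b, a < b →
    c s(.inl (copy T a), .inl (copy T b)) = pair (T.type a) (T.type b) (T.label a b)
  star_eq : ∀ T a b x, a < b →
    c s(.inl (copy T a), .inr x) = star (T.type a) (T.type b) (T.label a b) x
  not_mono : ∀ (i : Fin q) (f : Fin k → V ⊕ Fin k),
    ∃ a b, a < b ∧ (G.Adj (f a) (f b) → c s(f a, f b) ≠ i)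

namespace Response

variable {V : Type} {G : SimpleGraph (V ⊕ Fin k)} {c : Sym2 (V ⊕ Fin k) → Fin q}
  (R : Response k q G c)

theorem exists_pair_ne (T : Pattern k q) (i : Fin q) :
    ∃ a b, a < b ∧ R.pair (T.type a) (T.type b) (T.label a b) ≠ i := by
  obtain ⟨a, b, hab, h⟩ := R.not_mono i fun a => .inl (R.copy T a)
  exact ⟨a, b, hab, R.pair_eq T a b hab ▸ h (R.adj T a b hab)⟩

theorem pair_zero_injective (hk : 3 ≤ k) : Function.Injective (R.pair 0 0) := by
  intro i j h
  by_contra hij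
  let T : Pattern k q :=
    { type := fun _ => 0
      label := fun a b => if (a : ℕ) = 0 ∧ (b : ℕ) = k - 1 then j else i
      not_const := ⟨⟨0, by omega⟩, ⟨1, by omega⟩, ⟨0, by omega⟩, ⟨k - 1, by omega⟩, by simp,
        by simp; omega, by simp; grind⟩
      not_const_of_type := fun s hs d hd => by
        have h0 := hd ⟨0, by omega⟩
        have h1 := hd ⟨1, by omega⟩
        grind }
  obtain ⟨a, b, hab, hne⟩ := R.exists_pair_ne T (R.pair 0 0 i)
  grind

theorem eq_pair_of_forall_ne (hk : 3 ≤ k) {y j : Fin q} (h : ∀ i ≠ j, y ≠ R.pair 0 0 i) :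
    y = R.pair 0 0 j := by
  obtain ⟨i, rfl⟩ := Finite.injective_iff_surjective.mp (R.pair_zero_injective hk) y
  by_contra hne
  exact h i (fun hij => hne (by rw [hij])) rfl

theorem pair_zero_left (hk : 3 ≤ k) (s j : Fin q) : R.pair 0 s j = R.pair 0 0 j := by
  refine R.eq_pair_of_forall_ne hk fun i hij => ?_
  let T : Pattern k q :=
    { type := fun a => if (a : ℕ) = k - 1 then s else 0
      label := fun _ b => if (b : ℕ) = k - 1 then j else i
      not_const := ⟨⟨0, by omega⟩, ⟨1, by omega⟩, ⟨0, by omega⟩, ⟨k - 1, by omega⟩, by simp,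
        by simp; omega, by simp; grind⟩
      not_const_of_type := fun s hs d hd => by
        have h0 := hd ⟨0, by omega⟩
        have h1 := hd ⟨1, by omega⟩
        grind }
  obtain ⟨a, b, hab, hne⟩ := R.exists_pair_ne T (R.pair 0 0 i)
  have ha : ¬ (a : ℕ) = k - 1 := by omega
  grind

theorem pair_self (hk : 3 ≤ k) {s j : Fin q} (h : 4 ≤ k ∨ j ≠ s) :
    R.pair s s j = R.pair 0 0 j := by
  refine R.eq_pair_of_forall_ne hk fun i hij => ?_
  let T : Pattern k q :=
    { type := fun a => if k - 2 ≤ (a : ℕ) then s else 0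
      label := fun a b => if (a : ℕ) = k - 2 ∧ (b : ℕ) = k - 1 then j else i
      not_const := ⟨⟨0, by omega⟩, ⟨1, by omega⟩, ⟨k - 2, by omega⟩, ⟨k - 1, by omega⟩, by simp,
        by simp; omega, by simp; grind⟩
      not_const_of_type := fun s' hs d hd => by
        have h0 := hd ⟨0, by omega⟩
        have h1 := hd ⟨1, by omega⟩
        refine ⟨⟨k - 2, by omega⟩, ⟨k - 1, by omega⟩, ?_⟩
        grind }
  obtain ⟨a, b, hab, hne⟩ := R.exists_pair_ne T (R.pair 0 0 i)
  have h0 := R.pair_zero_left hk s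
  grind

theorem star_eq_pair (hk : 3 ≤ k) {s : Fin q} (hs : s ≠ 0) (x : Fin k) :
    R.star s 0 s x = R.pair 0 0 s := by
  refine R.eq_pair_of_forall_ne hk fun j hj hx => ?_
  let T : Pattern k q :=
    { type := fun a => if (a : ℕ) = k - 1 then 0 else s
      label := fun _ b => if (b : ℕ) = k - 1 then s else j
      not_const := ⟨⟨0, by omega⟩, ⟨1, by omega⟩, ⟨0, by omega⟩, ⟨k - 1, by omega⟩, by simp,
        by simp; omega, by simp; grind⟩
      not_const_of_type := fun s' hs d hd => by
        have h0 := hd ⟨0, by omega⟩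
        have hl := hd ⟨k - 1, by omega⟩
        refine ⟨⟨0, by omega⟩, ⟨1, by omega⟩, ?_⟩
        grind }
  obtain ⟨a, b, hab, h⟩ := R.not_mono (R.pair 0 0 j) fun a =>
    if (a : ℕ) = k - 1 then .inr x else .inl (R.copy T a)
  have ha : ¬ (a : ℕ) = k - 1 := by omega
  have hta : T.type a = s := if_neg ha
  by_cases hb : (b : ℕ) = k - 1
  · have htb : T.type b = 0 := if_pos hb
    have hl : T.label a b = s := if_pos hb
    simp only [ha, hb, if_true, if_false] at h
    refine h (R.adj_inr T a x (by rwa [hta])) ?_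
    rw [R.star_eq T a b x hab, hta, htb, hl, hx]
  · have htb : T.type b = s := if_neg hb
    have hl : T.label a b = j := if_neg hb
    simp only [ha, hb, if_false] at h
    refine h (R.adj T a b hab) ?_
    rw [R.pair_eq T a b hab, hta, htb, hl, R.pair_self hk (.inr hj)]

theorem clique_ne (hk : 3 ≤ k) {s : Fin q} (hs : s ≠ 0) {x y : Fin k} (hxy : x ≠ y) :
    c s(.inr x, .inr y) ≠ R.pair 0 0 s := by
  intro hc
  let T : Pattern k q :=
    { type := fun a => if k - 2 ≤ (a : ℕ) then 0 else s
      label := fun a b => if (a : ℕ) = k - 2 ∨ (b : ℕ) = k - 2 then 0 else s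
      not_const := ⟨⟨0, by omega⟩, ⟨k - 2, by omega⟩, ⟨0, by omega⟩, ⟨k - 1, by omega⟩,
        by simp; omega, by simp; omega, by simp; grind⟩
      not_const_of_type := fun s' hs d hd => by
        have h0 := hd ⟨k - 2, by omega⟩
        have hl := hd ⟨k - 1, by omega⟩
        grind }
  obtain ⟨a, b, hab, h⟩ := R.not_mono (R.pair 0 0 s) fun a =>
    if (a : ℕ) = k - 1 then .inr y else if (a : ℕ) = k - 2 then .inr x else .inl (R.copy T a)
  have ha : ¬ (a : ℕ) = k - 1 := by omega
  by_cases ha' : (a : ℕ) = k - 2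
  · have hb : (b : ℕ) = k - 1 := by omega
    simp only [ha', hb, show ¬ k - 2 = k - 1 by omega, if_true, if_false] at h
    exact h (R.adj_inr_inr x y hxy) hc
  have hta : T.type a = s := if_neg (by omega)
  have hstar : ∀ z, G.Adj (.inl (R.copy T a)) (.inr z) ∧
      c s(.inl (R.copy T a), .inr z) = R.pair 0 0 s := by
    intro z
    have hal : a < ⟨k - 1, by omega⟩ := by rw [Fin.lt_def]; simp only; omega
    have htl : T.type ⟨k - 1, by omega⟩ = 0 := if_pos (by simp only; omega)
    have hl : T.label a ⟨k - 1, by omega⟩ = s := if_neg (by simp only; omega)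
    exact ⟨R.adj_inr T a z (by rwa [hta]),
      by rw [R.star_eq T a _ z hal, hta, htl, hl, R.star_eq_pair hk hs]⟩
  simp only [ha, ha', if_false] at h
  split_ifs at h with hb hb'
  · exact h (hstar y).1 (hstar y).2
  · exact h (hstar x).1 (hstar x).2
  · have htb : T.type b = s := if_neg (by omega)
    have hl : T.label a b = s := if_neg (by omega)
    refine h (R.adj T a b hab) ?_
    rw [R.pair_eq T a b hab, hta, htb, hl, R.pair_self hk (.inl (by omega))]

/-- The attached clique is forced to be monochromatic, which is impossible. -/
theorem contradiction (R : Response k q G c) (hk : 3 ≤ k) : False := by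
  obtain ⟨a, b, hab, h⟩ := R.not_mono (R.pair 0 0 0) .inr
  exact h (R.adj_inr_inr a b hab.ne)
    (R.eq_pair_of_forall_ne hk fun s hs => R.clique_ne hk hs hab.ne)

end Response

end Forcing

theorem IsRamsey.of_iso {q : ℕ} {V V' W : Type*} {G : SimpleGraph V} {G' : SimpleGraph V'}
    {H : SimpleGraph W} (e : G ≃g G') (h : IsRamsey q G H) : IsRamsey q G' H := by
  intro c
  obtain ⟨i, f, hf⟩ := h fun s => c (s.map e)
  exact ⟨i, f.trans e.toEquiv.toEmbedding, fun a b hab =>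
    ⟨e.map_adj_iff.mpr (hf a b hab).1, (hf a b hab).2⟩⟩

theorem exists_lt_of_not_hasMonoCopy {k q : ℕ} {V : Type} {G : SimpleGraph V}
    {c : Sym2 V → Fin q} (h : ¬ HasMonoCopy G (⊤ : SimpleGraph (Fin k)) c) (i : Fin q)
    (f : Fin k → V) : ∃ a b, a < b ∧ (G.Adj (f a) (f b) → c s(f a, f b) ≠ i) := by
  by_contra! hf
  have hf' : ∀ a b, a ≠ b → G.Adj (f a) (f b) ∧ c s(f a, f b) = i := fun a b hab => by
    rcases lt_or_gt_of_ne hab with hab | hab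
    · exact hf a b hab
    · rw [Sym2.eq_swap, SimpleGraph.adj_comm]
      exact hf b a hab
  refine h ⟨i, ⟨f, fun a b hab => ?_⟩, hf'⟩
  by_contra hne
  exact (hf' a b hne).1.ne hab

theorem exists_isClean_isRamsey_extension (k q : ℕ) [NeZero q] (hk : 3 ≤ k) :
    ∃ (r : ℕ) (V : Type) (_ : Finite V) (Q : PartiteSystem (Fin r × Fin q) (Fin q) V),
      Q.IsClean k ∧ IsRamsey q (extension Q k) (⊤ : SimpleGraph (Fin k)) := by
  obtain ⟨r, hr⟩ := exists_homogeneous (κ := Fin q → Fin q → Fin q → Fin q × (Fin k → Fin q)) k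
  obtain ⟨V, hV, Q, hQ, hu⟩ := PartiteSystem.exists_uniform (κ := Fin q × (Fin k → Fin q))
    (Finset.univ : Finset ((Fin r × Fin q) × (Fin r × Fin q) × Fin q)).toList
    (patternSystem k q r)
  refine ⟨r, V, hV, Q, (patternSystem_isClean k q r hk).of_locallyMapsTo hk hQ, fun c => ?_⟩
  by_contra hno
  obtain ⟨φ, hφ, hφu⟩ := hu fun v w =>
    (c s(.inl v, .inl w), fun x => c s(.inl v, .inr x))
  simp only [Finset.mem_toList, Finset.mem_univ, true_imp_iff] at hφu
  choose F hF using hφu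
  obtain ⟨f, d, hf, hd⟩ := hr fun n m s t i => F ((n, s), (m, t), i)
  have key : ∀ (T : Pattern k q) (a b : Fin k), a < b →
      (patternSystem k q r).lab ((OrderEmbedding.ofStrictMono f hf, T), a)
        ((OrderEmbedding.ofStrictMono f hf, T), b) (T.label a b) := fun T a b hab =>
    ⟨rfl, hab.ne, by simp only [min_eq_left hab.le, max_eq_right hab.le]⟩
  have hcol := fun (T : Pattern k q) (a b : Fin k) (hab : a < b) =>
    (hF ((f a, T.type a), (f b, T.type b), T.label a b) _ _ rfl rfl (key T a b hab)).trans
      (congrFun (congrFun (congrFun (hd a b hab) _) _) _)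
  let R : Response k q (extension Q k) c :=
    { copy := fun T a => φ ((OrderEmbedding.ofStrictMono f hf, T), a)
      pair := fun s t i => (d s t i).1
      star := fun s t i => (d s t i).2
      adj := fun T a b hab => ⟨_, hφ.lab (key T a b hab)⟩
      adj_inr := fun T a x h => by
        change (Q.proj _).2 ≠ 0
        rwa [hφ.proj_eq]
      adj_inr_inr := fun x y h => h
      pair_eq := fun T a b hab => congrArg Prod.fst (hcol T a b hab)
      star_eq := fun T a b x hab => congrFun (congrArg Prod.snd (hcol T a b hab)) x
      not_mono := exists_lt_of_not_hasMonoCopy hno }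
  exact R.contradiction hk

/-- For all `k, q ≥ 3`, there is a graph that is `q`-Ramsey for `K_k`
but not `q`-Ramsey for `K_k · K₂`; in particular `K_k` and `K_k · K₂` are not
`q`-Ramsey-equivalent. -/
theorem stmt7 (k q : ℕ) (hk : 3 ≤ k) (hq : 3 ≤ q) :
    ∃ (n : ℕ) (G : SimpleGraph (Fin n)),
      IsRamsey q G (⊤ : SimpleGraph (Fin k)) ∧ ¬ IsRamsey q G (cliqueWithPendant k) := by
  have : NeZero q := ⟨by omega⟩
  obtain ⟨r, V, _, Q, hQ, hR⟩ := exists_isClean_isRamsey_extension k q hk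
  obtain ⟨n, ⟨e⟩⟩ := Finite.exists_equiv_fin (V ⊕ Fin k)
  let φ : extension Q k ≃g (extension Q k).map e.toEmbedding := SimpleGraph.Iso.map e _
  exact ⟨n, _, hR.of_iso φ, fun h => not_isRamsey_extension hk hQ (h.of_iso φ.symm)⟩
end
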